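/- arXiv:2204.00066 — 2 statements merged into one kernel-verified Lean document; each statement's English description precedes it below -/
import Mathlib

section
/- Let λ be a partition of n, let α₁ be the number of parts of λ equal to 1, and let λ⁺ be the partition of n+1 obtained from λ by appending one additional part equal to 1. Then x^{α₁+1} divides R_{λ⁺}(x) − R_λ(x); equivalently, R_{λ⁺} and R_λ have equal coefficients in degrees 0, 1, …, α₁. -/
open Polynomial

/-- `f` represents the partition `λ₁ ≥ λ₂ ≥ … ≥ λ_N > 0` of `n`:
`f i = λᵢ` for `1 ≤ i ≤ N` and `f i = 0` for `i > N`. -/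
def IsPartitionFun (f : ℕ → ℕ) (n N : ℕ) : Prop :=
  (∀ i j, i ≤ j → f j ≤ f i) ∧ (∀ i, 1 ≤ i → (0 < f i ↔ i ≤ N)) ∧
    ∑ i ∈ Finset.Icc 1 N, f i = n

/-- `A` is strictly upper triangular: `A i j = 0` whenever `j ≤ i`. -/
def StrictUpper {m : ℕ} {F : Type*} [Zero F] (A : Matrix (Fin m) (Fin m) F) : Prop :=
  ∀ i j : Fin m, (j : ℕ) ≤ (i : ℕ) → A i j = 0

/-- `A` has Jordan type `λ`: `rank (A ^ k) = Σᵢ max (λᵢ - k) 0` for every `k ≥ 0`. -/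
def HasJordanType {m : ℕ} {F : Type*} [Field F] (A : Matrix (Fin m) (Fin m) F)
    (f : ℕ → ℕ) (N : ℕ) : Prop :=
  ∀ k : ℕ, (A ^ k).rank = ∑ i ∈ Finset.Icc 1 N, (f i - k)

/-- The number of strictly upper triangular `m × m` matrices over `F` of Jordan type `λ`. -/
noncomputable def jordanCount (m : ℕ) (f : ℕ → ℕ) (N : ℕ)
    (F : Type) [Field F] [Fintype F] : ℕ :=
  Nat.card {A : Matrix (Fin m) (Fin m) F // StrictUpper A ∧ HasJordanType A f N}

/-- `dualPart f N j = λ'_j`, the number of parts of `λ` that are `≥ j`. -/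
def dualPart (f : ℕ → ℕ) (N j : ℕ) : ℕ :=
  ((Finset.Icc 1 N).filter fun i => j ≤ f i).card

/-- `alphaCount f N k = α_k`, the number of parts of `λ` equal to `k`. -/
def alphaCount (f : ℕ → ℕ) (N k : ℕ) : ℕ :=
  ((Finset.Icc 1 N).filter fun i => f i = k).card

/-- The rows containing a removable cell of the Young diagram of `λ`:
rows `1 ≤ i ≤ N` with `i = N` or `λ_{i+1} < λᵢ` (for `i = N` the condition
`f (i+1) < f i` holds automatically since `f (N+1) = 0 < f N`). -/
def removables (f : ℕ → ℕ) (N : ℕ) : Finset ℕ :=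
  (Finset.Icc 1 N).filter fun i => f (i + 1) < f i

/-- `c` lists the column lengths of a Young diagram with `m` cells. -/
def IsColumnFun (c : ℕ → ℕ) (m : ℕ) : Prop :=
  Antitone c ∧ ∃ K, ∀ M, K ≤ M → ∑ i ∈ Finset.range M, c i = m

/-- Remove the bottom cell of column `j`. -/
def removeCell (c : ℕ → ℕ) (j : ℕ) : ℕ → ℕ := Function.update c j (c j - 1)

/-- Add a cell at the bottom of the first column. -/
def addRow (c : ℕ → ℕ) : ℕ → ℕ := Function.update c 0 (c 0 + 1)

/-- The weight of the removal of the cell in column `j` from a diagram with `m + 1` cells. -/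
noncomputable def cellWeight (m : ℕ) (c : ℕ → ℕ) : ℕ → ℕ[X]
  | 0 => X ^ (m + 1 - c 0)
  | j + 1 => X ^ (m - c j) * ∑ i ∈ Finset.range (c j - c (j + 1) + 1), X ^ i

/-- The Jordan counting polynomial with its power of `X - 1` removed. -/
noncomputable def columnPoly : ℕ → (ℕ → ℕ) → ℕ[X]
  | 0, _ => 1
  | m + 1, c => ∑ j ∈ Finset.range (m + 1),
      if c (j + 1) < c j then cellWeight m c j * columnPoly m (removeCell c j) else 0

namespace IsColumnFun

variable {c : ℕ → ℕ} {m : ℕ}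

theorem sum_range_le (h : IsColumnFun c m) (k : ℕ) : ∑ i ∈ Finset.range k, c i ≤ m := by
  obtain ⟨-, K, hK⟩ := h
  rw [← hK (max k K) (le_max_right _ _)]
  exact Finset.sum_le_sum_of_subset (Finset.range_mono (le_max_left _ _))

theorem apply_eq_zero (h : IsColumnFun c m) {j : ℕ} (hj : m ≤ j) : c j = 0 := by
  by_contra h0
  have h1 := h.sum_range_le (j + 1)
  have h2 : ∑ i ∈ Finset.range (j + 1), 1 ≤ ∑ i ∈ Finset.range (j + 1), c i :=
    Finset.sum_le_sum fun i hi => by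
      have := h.1 (Nat.lt_succ_iff.1 (Finset.mem_range.1 hi))
      omega
  simp at h2
  omega

theorem removeCell (h : IsColumnFun c (m + 1)) {j : ℕ} (hj : c (j + 1) < c j) :
    IsColumnFun (removeCell c j) m := by
  obtain ⟨ha, K, hK⟩ := h
  refine ⟨antitone_nat_of_succ_le fun i => ?_, max K (j + 1), fun M hM => ?_⟩
  · have := ha (Nat.le_succ i)
    unfold _root_.removeCell
    simp only [Function.update_apply]
    split_ifs <;> grind
  · have hjM : j ∈ Finset.range M := by simp; omega
    have h1 := hK M (by omega)
    rw [← Finset.add_sum_erase _ _ hjM] at h1 ⊢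
    have h2 : ∑ i ∈ (Finset.range M).erase j, _root_.removeCell c j i
        = ∑ i ∈ (Finset.range M).erase j, c i :=
      Finset.sum_congr rfl fun i hi => by
        simp [_root_.removeCell, Function.update_of_ne (Finset.ne_of_mem_erase hi)]
    rw [h2]
    simp [_root_.removeCell]
    omega

theorem addRow (h : IsColumnFun c m) : IsColumnFun (addRow c) (m + 1) := by
  obtain ⟨ha, K, hK⟩ := h
  refine ⟨antitone_nat_of_succ_le fun i => ?_, K + 1, fun M hM => ?_⟩
  · have := ha (Nat.le_succ i)
    unfold _root_.addRow
    simp only [Function.update_apply]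
    split_ifs <;> grind
  · obtain ⟨M, rfl⟩ : ∃ k, M = k + 1 := ⟨M - 1, by omega⟩
    have h1 := hK (M + 1) (by omega)
    rw [Finset.sum_range_succ'] at h1 ⊢
    simp [_root_.addRow]
    omega

theorem add_le (h : IsColumnFun c m) (i j : ℕ) (hij : i < j) : c i + c j ≤ m := by
  have := h.sum_range_le (j + 1)
  rw [Finset.sum_range_succ] at this
  have h2 := Finset.single_le_sum (f := c) (fun _ _ => Nat.zero_le _) (Finset.mem_range.2 hij)
  omega

theorem columnPoly_succ (h : IsColumnFun c (m + 1)) {K : ℕ} (hK : m + 1 ≤ K) :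
    columnPoly (m + 1) c = ∑ j ∈ Finset.range K,
      if c (j + 1) < c j then cellWeight m c j * columnPoly m (_root_.removeCell c j) else 0 := by
  rw [columnPoly]
  refine Finset.sum_subset (Finset.range_mono hK) fun j _ hj => if_neg ?_
  rw [h.apply_eq_zero (j := j) (by simpa using hj)]
  omega

theorem exists_corner (h : IsColumnFun c (m + 1)) : ∃ j < m + 1, c (j + 1) < c j := by
  by_contra! hc
  have h0 : ∀ j ≤ m + 1, c 0 ≤ c j := fun j => by
    induction j with
    | zero => simp
    | succ j ih => intro hj; exact (ih (by omega)).trans (hc j (by omega))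
  have h1 := h0 (m + 1) le_rfl
  rw [h.apply_eq_zero le_rfl] at h1
  obtain ⟨ha, K, hK⟩ := h
  have h2 := hK K le_rfl
  rw [Finset.sum_eq_zero fun i _ => ?_] at h2
  · omega
  · have := ha (Nat.zero_le i)
    omega

end IsColumnFun

theorem removeCell_addRow_zero (c : ℕ → ℕ) : removeCell (addRow c) 0 = c := by
  ext i; simp [removeCell, addRow]

theorem addRow_removeCell_zero {c : ℕ → ℕ} (h : 0 < c 0) : addRow (removeCell c 0) = c := by
  ext i
  simp only [removeCell, addRow, Function.update_apply]
  split_ifs with h <;> simp [h]; omega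

theorem removeCell_addRow_succ (c : ℕ → ℕ) (j : ℕ) :
    removeCell (addRow c) (j + 1) = addRow (removeCell c (j + 1)) := by
  ext i
  simp only [removeCell, addRow, Function.update_apply]
  grind

theorem columnPoly_eval_one_pos {c : ℕ → ℕ} {m : ℕ} (h : IsColumnFun c m) :
    0 < (columnPoly m c).eval 1 := by
  induction m generalizing c with
  | zero => simp [columnPoly]
  | succ m ih =>
    obtain ⟨j, hj, hc⟩ := h.exists_corner
    rw [columnPoly, eval_finsetSum]
    refine Finset.sum_pos' (fun _ _ => Nat.zero_le _) ⟨j, Finset.mem_range.2 hj, ?_⟩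
    rw [if_pos hc, eval_mul]
    refine Nat.mul_pos ?_ (ih (h.removeCell hc))
    cases j <;> simp [cellWeight, eval_finsetSum]

theorem X_pow_dvd_map_intCast {p : ℕ[X]} {d : ℕ} :
    (X : ℤ[X]) ^ d ∣ p.map (Nat.castRingHom ℤ) ↔ X ^ d ∣ p := by
  simp [X_pow_dvd_iff]

theorem X_pow_dvd_of_X_pow_dvd_sum {ι : Type*} {s : Finset ι} {p : ι → ℕ[X]} {d : ℕ}
    (h : X ^ d ∣ ∑ i ∈ s, p i) {i : ι} (hi : i ∈ s) : X ^ d ∣ p i := by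
  rw [X_pow_dvd_iff] at h ⊢
  intro k hk
  have := h k hk
  rw [finsetSum_coeff, Finset.sum_eq_zero_iff] at this
  exact this i hi

theorem X_pow_sub_dvd_of_dvd_X_pow_mul {R : Type*} [Semiring R] {p : R[X]} {d a : ℕ}
    (h : X ^ d ∣ X ^ a * p) : X ^ (d - a) ∣ p := by
  rw [X_pow_dvd_iff] at h ⊢
  intro k hk
  have := h (k + a) (by omega)
  rwa [coeff_X_pow_mul] at this

theorem X_pow_sub_dvd_of_dvd_cellWeight_mul {m d j : ℕ} {c : ℕ → ℕ} {p : ℕ[X]}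
    (h : X ^ d ∣ cellWeight m c (j + 1) * p) : X ^ (d - (m - c j)) ∣ p := by
  rw [cellWeight, mul_assoc, Finset.sum_mul, Finset.mul_sum] at h
  have := X_pow_dvd_of_X_pow_dvd_sum h (i := 0) (by simp)
  exact X_pow_sub_dvd_of_dvd_X_pow_mul (by simpa using this)

/-- `columnPoly` over the integers. -/
noncomputable def columnPolyInt (m : ℕ) (c : ℕ → ℕ) : ℤ[X] :=
  (columnPoly m c).map (Nat.castRingHom ℤ)

/-- `cellWeight` over the integers. -/
noncomputable def cellWeightInt (m : ℕ) (c : ℕ → ℕ) (j : ℕ) : ℤ[X] :=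
  (cellWeight m c j).map (Nat.castRingHom ℤ)

theorem cellWeightInt_zero (m : ℕ) (c : ℕ → ℕ) : cellWeightInt m c 0 = X ^ (m + 1 - c 0) := by
  simp [cellWeightInt, cellWeight]

theorem cellWeightInt_succ (m : ℕ) (c : ℕ → ℕ) (j : ℕ) : cellWeightInt m c (j + 1) =
    X ^ (m - c j) * ∑ i ∈ Finset.range (c j - c (j + 1) + 1), X ^ i := by
  simp [cellWeightInt, cellWeight, Polynomial.map_sum]

theorem IsColumnFun.columnPolyInt_succ {m : ℕ} {c : ℕ → ℕ} (h : IsColumnFun c (m + 1)) {K : ℕ}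
    (hK : m + 1 ≤ K) :
    columnPolyInt (m + 1) c = ∑ j ∈ Finset.range K,
      if c (j + 1) < c j then cellWeightInt m c j * columnPolyInt m (_root_.removeCell c j)
        else 0 := by
  rw [columnPolyInt, h.columnPoly_succ hK, Polynomial.map_sum]
  refine Finset.sum_congr rfl fun j _ => ?_
  split_ifs <;> simp [columnPolyInt, cellWeightInt]

/-- Adding a part equal to `1` shifts the lowest coefficients of `columnPoly`. -/
theorem X_pow_dvd_columnPolyInt_addRow_sub {m : ℕ} {c : ℕ → ℕ} (h : IsColumnFun c m) (d : ℕ)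
    (hd : X ^ d ∣ columnPoly m c) :
    (X : ℤ[X]) ^ (m - c 0 - c 1 + d + (c 0 - c 1) + 1) ∣
      columnPolyInt (m + 1) (addRow c) - X ^ (m - c 0 - c 1) * columnPolyInt m c := by
  induction m generalizing c d with
  | zero =>
    have h0 : c = 0 := by ext i; exact h.apply_eq_zero (Nat.zero_le _)
    subst h0
    simp [columnPolyInt, columnPoly, addRow, cellWeight]
  | succ m ih =>
    have h01 := h.add_le 0 1 one_pos
    have ha01 := h.1 zero_le_one
    have hsum := hd
    rw [h.columnPoly_succ (Nat.le_succ (m + 1))] at hsum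
    have hterm : ∀ j < m + 1 + 1, c (j + 1) < c j →
        X ^ d ∣ cellWeight m c j * columnPoly m (removeCell c j) := fun j hj hc => by
      have := X_pow_dvd_of_X_pow_dvd_sum hsum (Finset.mem_range.2 hj)
      rwa [if_pos hc] at this
    rw [h.addRow.columnPolyInt_succ le_rfl, h.columnPolyInt_succ (Nat.le_succ (m + 1)),
      Finset.mul_sum, ← Finset.sum_sub_distrib]
    refine Finset.dvd_sum fun j hj => ?_
    rw [Finset.mem_range] at hj
    rcases j with _ | j
    · rw [removeCell_addRow_zero, if_pos (by simp [addRow]; omega), cellWeightInt_zero,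
        cellWeightInt_zero]
      have e1 : m + 1 + 1 - addRow c 0 = m + 1 - c 0 := by simp [addRow]
      rw [e1]
      by_cases hc : c (0 + 1) < c 0
      · rw [if_pos hc]
        have hr0 : removeCell c 0 0 = c 0 - 1 := by simp [removeCell]
        have hr1 : removeCell c 0 1 = c 1 := by simp [removeCell]
        have hν := fun s => ih (h.removeCell hc) s
        rw [addRow_removeCell_zero (by omega), hr0, hr1] at hν
        rcases Nat.eq_zero_or_pos (c 1) with hc1 | hc1
        · have hz : ∀ i, c (i + 1) = 0 := fun i => by
            have := h.1 (show 1 ≤ i + 1 by omega)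
            omega
          have hc0 : c 0 = m + 1 := by
            obtain ⟨-, K, hK⟩ := h
            have := hK (K + 1) (by omega)
            rw [Finset.sum_range_succ'] at this
            simpa [hz] using this
          have heq : columnPolyInt (m + 1) c = columnPolyInt m (removeCell c 0) := by
            rw [h.columnPolyInt_succ le_rfl, Finset.sum_range_succ']
            simp [hz, hc0, cellWeightInt_zero]
          rw [heq]
          simp [hc0]
        · have hs : ∀ s ≤ d - (m + 1 - c 0 - c 1), X ^ s ∣ columnPoly m (removeCell c 0) := by
            intro s
            induction s with
            | zero => simp
            | succ s ihs =>
              intro hsd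
              have h1 := (pow_dvd_pow (X : ℤ[X]) (show m + 1 - c 0 - c 1 + (s + 1) ≤ _ by omega)
                ).trans (hν s (ihs (by omega)))
              have h2 : (X : ℤ[X]) ^ (m + 1 - c 0 - c 1 + (s + 1)) ∣ columnPolyInt (m + 1) c :=
                (pow_dvd_pow _ (by omega)).trans (X_pow_dvd_map_intCast.2 hd)
              have h3 := (dvd_sub_right h2).1 h1
              have h4 := X_pow_sub_dvd_of_dvd_X_pow_mul h3
              rw [show m + 1 - c 0 - c 1 + (s + 1) - (m - (c 0 - 1) - c 1) = s + 1 by omega] at h4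
              exact X_pow_dvd_map_intCast.1 h4
          have h1 := mul_dvd_mul_left ((X : ℤ[X]) ^ (m + 1 - c 0)) (hν _ (hs _ le_rfl))
          rw [← pow_add] at h1
          refine (pow_dvd_pow _ ?_).trans (h1.trans (dvd_of_eq ?_))
          · omega
          · rw [show m - (c 0 - 1) - c 1 = m + 1 - c 0 - c 1 by omega]
            ring
      · have hc0 : 1 ≤ c 0 := by
          obtain ⟨i, -, hi⟩ := h.exists_corner
          have := h.1 (Nat.zero_le i)
          omega
        rw [if_neg hc, mul_zero, sub_zero]
        have h1 := mul_dvd_mul_left ((X : ℤ[X]) ^ (m + 1 - c 0)) (X_pow_dvd_map_intCast.2 hd)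
        rw [← pow_add] at h1
        rw [zero_add] at hc
        exact (pow_dvd_pow _ (by omega)).trans h1
    · have e2 : addRow c (j + 1) = c (j + 1) := by simp [addRow]
      have e3 : addRow c (j + 1 + 1) = c (j + 1 + 1) := by simp [addRow]
      rw [e2, e3]
      by_cases hc : c (j + 1 + 1) < c (j + 1)
      swap
      · simp [hc]
      rw [if_pos hc, if_pos hc, removeCell_addRow_succ]
      have hdj := X_pow_sub_dvd_of_dvd_cellWeight_mul (hterm _ hj hc)
      have hih := ih (h.removeCell hc) _ hdj
      have hjj := h.add_le j (j + 1) (Nat.lt_succ_self j)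
      rw [cellWeightInt_succ, cellWeightInt_succ]
      rcases j with _ | j
      · have hr0 : removeCell c 1 0 = c 0 := by simp [removeCell]
        have hr1 : removeCell c 1 1 = c 1 - 1 := by simp [removeCell]
        simp only [zero_add] at hc hih hdj ⊢
        rw [hr0, hr1] at hih
        have e4 : addRow c 0 = c 0 + 1 := by simp [addRow]
        rw [e4, show addRow c 1 = c 1 by simp [addRow],
          show c 0 + 1 - c 1 + 1 = c 0 - c 1 + 1 + 1 by omega, Finset.sum_range_succ,
          show m + 1 - (c 0 + 1) = m - c 0 by omega]
        rw [show m - c 0 - (c 1 - 1) = m + 1 - c 0 - c 1 by omega] at hih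
        have h1 := mul_dvd_mul_left ((X : ℤ[X]) ^ (m - c 0)) hih
        have h2 := mul_dvd_mul_left ((X : ℤ[X]) ^ (m - c 0 + (m + 1 - c 0 - c 1) + (c 0 - c 1 + 1)))
          (X_pow_dvd_map_intCast.2 hdj)
        rw [← pow_add] at h1 h2
        have h1 := (pow_dvd_pow (X : ℤ[X]) (show m + 1 - c 0 - c 1 + d + (c 0 - c 1) + 1 ≤ _ by
          omega)).trans h1
        have h2 := (pow_dvd_pow (X : ℤ[X]) (show m + 1 - c 0 - c 1 + d + (c 0 - c 1) + 1 ≤ _ by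
          omega)).trans h2
        refine (dvd_add (dvd_mul_of_dvd_left h1 (∑ i ∈ Finset.range (c 0 - c 1 + 1), X ^ i +
          X ^ (c 0 - c 1 + 1))) h2).trans (dvd_of_eq ?_)
        rw [show Polynomial.map (Nat.castRingHom ℤ) (columnPoly m (removeCell c 1)) =
          columnPolyInt m (removeCell c 1) from rfl]
        ring
      · have hr0 : removeCell c (j + 1 + 1) 0 = c 0 := by simp [removeCell]
        have hr1 : removeCell c (j + 1 + 1) 1 = c 1 := by simp [removeCell]
        have h3 : c 0 + c 1 + c (j + 1 + 1) ≤ m + 1 := by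
          have := h.sum_range_le (j + 1 + 1 + 1)
          rw [Finset.sum_range_succ, Finset.sum_range_succ', Finset.sum_range_succ'] at this
          have e5 : c (0 + 1) = c 1 := rfl
          have e6 : c (j + 2) = c (j + 1 + 1) := rfl
          omega
        rw [hr0, hr1] at hih
        have h1 := mul_dvd_mul_left ((X : ℤ[X]) ^ (m + 1 - c (j + 1))) hih
        rw [← pow_add] at h1
        have h1 := (pow_dvd_pow (X : ℤ[X]) (show m + 1 - c 0 - c 1 + d + (c 0 - c 1) + 1 ≤ _ by
          omega)).trans h1
        rw [e2, show addRow c (j + 1) = c (j + 1) by simp [addRow]]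
        refine (dvd_mul_of_dvd_left h1 (∑ i ∈ Finset.range (c (j + 1) - c (j + 1 + 1) + 1),
          X ^ i)).trans (dvd_of_eq ?_)
        rw [show m + 1 - c (j + 1) = m - c (j + 1) + 1 by omega,
          show m + 1 - c 0 - c 1 = m - c 0 - c 1 + 1 by omega]
        ring

section Matrices

variable {F : Type*} [Field F] {m : ℕ}

/-- The vectors `v` such that `B ^ k v` lies in the range of `B ^ (k + 1)`. -/
def powRangeComap (B : Matrix (Fin m) (Fin m) F) (k : ℕ) : Submodule F (Fin m → F) :=
  (LinearMap.range (B ^ (k + 1)).mulVecLin).comap (B ^ k).mulVecLin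

theorem powRangeComap_mono (B : Matrix (Fin m) (Fin m) F) : Monotone (powRangeComap B) := by
  refine monotone_nat_of_le_succ fun k v hv => ?_
  obtain ⟨w, hw⟩ := hv
  refine ⟨w, ?_⟩
  simp only [Matrix.mulVecLin_apply] at hw ⊢
  rw [pow_succ' B (k + 1), ← Matrix.mulVec_mulVec, hw, Matrix.mulVec_mulVec, ← pow_succ']

theorem finrank_powRangeComap_add_rank (B : Matrix (Fin m) (Fin m) F) (k : ℕ) :
    Module.finrank F (powRangeComap B k) + (B ^ k).rank = m + (B ^ (k + 1)).rank := by
  have hle : LinearMap.range (B ^ (k + 1)).mulVecLin ≤ LinearMap.range (B ^ k).mulVecLin := by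
    rw [pow_succ, Matrix.mulVecLin_mul]
    exact LinearMap.range_comp_le_range _ _
  have h1 := ((B ^ k).mulVecLin.domRestrict (powRangeComap B k)).finrank_range_add_finrank_ker
  have h2 := (B ^ k).mulVecLin.finrank_range_add_finrank_ker
  have hker : LinearMap.ker (B ^ k).mulVecLin ≤ powRangeComap B k := fun v hv => by
    change (B ^ k).mulVecLin v ∈ LinearMap.range (B ^ (k + 1)).mulVecLin
    rw [LinearMap.mem_ker.1 hv]
    exact Submodule.zero_mem _
  rw [LinearMap.range_domRestrict, LinearMap.ker_domRestrict,
    (Submodule.comapSubtypeEquivOfLe hker).finrank_eq, powRangeComap, Submodule.map_comap_eq,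
    inf_eq_right.2 hle] at h1
  rw [Module.finrank_fin_fun] at h2
  unfold Matrix.rank
  unfold powRangeComap
  omega

theorem StrictUpper.pow_apply_eq_zero {B : Matrix (Fin m) (Fin m) F} (hB : StrictUpper B) (k : ℕ)
    (i j : Fin m) (hij : (j : ℕ) < i + k) : (B ^ k) i j = 0 := by
  induction k generalizing j with
  | zero => rw [pow_zero, Matrix.one_apply_ne (by rintro rfl; simp at hij)]
  | succ k ih =>
    rw [pow_succ, Matrix.mul_apply]
    refine Finset.sum_eq_zero fun l _ => ?_
    rcases lt_or_ge (l : ℕ) (i + k) with h | h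
    · rw [ih l h, zero_mul]
    · rw [hB l j (by omega), mul_zero]

theorem StrictUpper.pow_eq_zero {B : Matrix (Fin m) (Fin m) F} (hB : StrictUpper B) :
    B ^ m = 0 := by
  ext i j
  exact hB.pow_apply_eq_zero m i j (by omega)

/-- The block matrix with blocks `B`, the column `v`, and zeros below. -/
def borderBlock (B : Matrix (Fin m) (Fin m) F) (v : Fin m → F) :
    Matrix (Fin m ⊕ Fin 1) (Fin m ⊕ Fin 1) F :=
  Matrix.fromBlocks B (Matrix.replicateCol (Fin 1) v) 0 0

/-- The matrix `B` bordered by the column `v` on the right and a zero row below. -/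
def borderColumn (B : Matrix (Fin m) (Fin m) F) (v : Fin m → F) :
    Matrix (Fin (m + 1)) (Fin (m + 1)) F :=
  Matrix.reindexAlgEquiv F F finSumFinEquiv (borderBlock B v)

theorem rank_borderBlock (B : Matrix (Fin m) (Fin m) F) (v : Fin m → F)
    [Decidable (v ∈ LinearMap.range B.mulVecLin)] :
    (borderBlock B v).rank =
      B.rank + if v ∈ LinearMap.range B.mulVecLin then 0 else 1 := by
  set V := Matrix.replicateCol (Fin 1) v
  have h1 : (borderBlock B v).rank =
      (Matrix.fromCols B V).rank := by
    have e : borderBlock B v =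
        Matrix.fromRows (Matrix.fromCols B V) 0 := by
      ext i j
      rcases i with i | i <;> rcases j with j | j <;> rfl
    rw [e]
    refine le_antisymm ?_ ?_
    · have : Matrix.fromRows (Matrix.fromCols B V) (0 : Matrix (Fin 1) (Fin m ⊕ Fin 1) F) =
          Matrix.fromRows (1 : Matrix (Fin m) (Fin m) F) (0 : Matrix (Fin 1) (Fin m) F) *
             Matrix.fromCols B V := by
        rw [Matrix.fromRows_mul, Matrix.one_mul, Matrix.zero_mul]
      rw [this]
      exact Matrix.rank_mul_le_right _ _
    · have : Matrix.fromCols B V = Matrix.fromCols (1 : Matrix (Fin m) (Fin m) F) (0 : Matrix (Fin m) (Fin 1) F) *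
          Matrix.fromRows (Matrix.fromCols B V) (0 : Matrix (Fin 1) (Fin m ⊕ Fin 1) F) := by
        rw [Matrix.fromCols_mul_fromRows, Matrix.one_mul, Matrix.zero_mul, add_zero]
      conv_lhs => rw [this]
      exact Matrix.rank_mul_le_right _ _
  have h2 : LinearMap.range (Matrix.fromCols B V).mulVecLin =
      LinearMap.range B.mulVecLin ⊔ Submodule.span F {v} := by
    rw [Matrix.range_mulVecLin, Matrix.range_mulVecLin, ← Submodule.span_union]
    congr 1
    ext w
    simp only [Set.mem_range, Sum.exists, Set.mem_union, Set.mem_singleton_iff]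
    refine or_congr Iff.rfl ⟨?_, ?_⟩
    · rintro ⟨_, rfl⟩
      rfl
    · rintro rfl
      exact ⟨0, rfl⟩
  rw [h1, Matrix.rank, h2]
  split_ifs with h
  · rw [sup_eq_left.2 ((Submodule.span_singleton_le_iff_mem _ _).2 h)]
    rfl
  · rw [Submodule.finrank_sup_span_singleton h]
    rfl

theorem borderBlock_pow_succ (B : Matrix (Fin m) (Fin m) F) (v : Fin m → F) (k : ℕ) :
    borderBlock B v ^ (k + 1) = borderBlock (B ^ (k + 1)) ((B ^ k).mulVec v) := by
  induction k with
  | zero => simp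
  | succ k ih =>
    rw [pow_succ', ih, borderBlock, borderBlock, borderBlock, Matrix.fromBlocks_multiply,
      pow_succ' B (k + 1), ← Matrix.replicateCol_mulVec, Matrix.mulVec_mulVec, ← pow_succ']
    simp [← pow_succ']

theorem rank_borderColumn_pow_succ (B : Matrix (Fin m) (Fin m) F) (v : Fin m → F) (k : ℕ)
    [Decidable (v ∈ powRangeComap B k)] :
    (borderColumn B v ^ (k + 1)).rank =
      (B ^ (k + 1)).rank + if v ∈ powRangeComap B k then 0 else 1 := by
  classical
  rw [borderColumn, ← map_pow, borderBlock_pow_succ, Matrix.coe_reindexAlgEquiv,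
    Matrix.rank_reindex, rank_borderBlock]
  congr 1
  exact if_congr Iff.rfl rfl rfl

theorem borderColumn_apply (B : Matrix (Fin m) (Fin m) F) (v : Fin m → F) (x y : Fin m ⊕ Fin 1) :
    borderColumn B v (finSumFinEquiv x) (finSumFinEquiv y) = borderBlock B v x y := by
  simp [borderColumn]

theorem strictUpper_borderColumn_iff {B : Matrix (Fin m) (Fin m) F} {v : Fin m → F} :
    StrictUpper (borderColumn B v) ↔ StrictUpper B := by
  constructor
  · intro h i j hij
    have := h (finSumFinEquiv (.inl i)) (finSumFinEquiv (.inl j)) (by simpa using hij)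
    rwa [borderColumn_apply] at this
  · intro h i j
    obtain ⟨x, rfl⟩ := finSumFinEquiv.surjective i
    obtain ⟨y, rfl⟩ := finSumFinEquiv.surjective j
    rw [borderColumn_apply]
    intro hxy
    rcases x with x | x <;> rcases y with y | y
    · exact h x y (by simpa using hxy)
    · simp at hxy
      omega
    · rfl
    · rfl

theorem exists_eq_borderColumn {A : Matrix (Fin (m + 1)) (Fin (m + 1)) F} (hA : StrictUpper A) :
    ∃ p : Matrix (Fin m) (Fin m) F × (Fin m → F), borderColumn p.1 p.2 = A := by
  refine ⟨(fun i j => A (finSumFinEquiv (.inl i)) (finSumFinEquiv (.inl j)),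
    fun i => A (finSumFinEquiv (.inl i)) (finSumFinEquiv (.inr 0))), ?_⟩
  ext i j
  obtain ⟨x, rfl⟩ := finSumFinEquiv.surjective i
  obtain ⟨y, rfl⟩ := finSumFinEquiv.surjective j
  rw [borderColumn_apply]
  rcases x with x | x <;> rcases y with y | y
  · rfl
  · rw [Subsingleton.elim y 0]
    rfl
  · exact (hA _ _ (by simp)).symm
  · exact (hA _ _ (by simp)).symm

theorem borderColumn_injective : Function.Injective
    fun p : Matrix (Fin m) (Fin m) F × (Fin m → F) => borderColumn p.1 p.2 := by
  rintro ⟨B, v⟩ ⟨B', v'⟩ h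
  have h1 := fun x y => congr_fun₂ h (finSumFinEquiv x) (finSumFinEquiv y)
  simp only [borderColumn_apply] at h1
  refine Prod.ext ?_ ?_
  · ext i j
    exact h1 (.inl i) (.inl j)
  · ext i
    exact h1 (.inl i) (.inr 0)

/-- The powers of `A` have the ranks prescribed by the column lengths `c`. -/
def HasColumns (A : Matrix (Fin m) (Fin m) F) (c : ℕ → ℕ) : Prop :=
  ∀ k, (A ^ k).rank + ∑ i ∈ Finset.range k, c i = m

theorem HasColumns.finrank_powRangeComap_add {B : Matrix (Fin m) (Fin m) F} {c : ℕ → ℕ}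
    (h : HasColumns B c) (k : ℕ) : Module.finrank F (powRangeComap B k) + c k = m := by
  have h1 := finrank_powRangeComap_add_rank B k
  have h2 := h k
  have h3 := h (k + 1)
  rw [Finset.sum_range_succ] at h3
  omega

theorem sum_range_removeCell {c : ℕ → ℕ} {j : ℕ} (hj : 0 < c j) (k : ℕ) :
    ∑ i ∈ Finset.range k, removeCell c j i + (if j < k then 1 else 0) =
      ∑ i ∈ Finset.range k, c i := by
  induction k with
  | zero => simp
  | succ k ih =>
    rw [Finset.sum_range_succ, Finset.sum_range_succ, ← ih]
    simp only [removeCell, Function.update_apply]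
    grind

theorem hasColumns_borderColumn_iff {B : Matrix (Fin m) (Fin m) F} {v : Fin m → F} {j : ℕ}
    (hv : ∀ k, v ∈ powRangeComap B k ↔ j ≤ k) {c : ℕ → ℕ} :
    HasColumns (borderColumn B v) c ↔ c (j + 1) < c j ∧ HasColumns B (removeCell c j) := by
  classical
  have hrank : ∀ k, (borderColumn B v ^ k).rank + (if j < k then 1 else 0) =
      (B ^ k).rank + 1 := by
    intro k
    cases k with
    | zero => simp
    | succ k =>
      rw [rank_borderColumn_pow_succ, add_assoc]
      simp only [hv]
      split_ifs <;> omega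
  have hiff : 0 < c j → (HasColumns (borderColumn B v) c ↔ HasColumns B (removeCell c j)) := by
    intro hj
    refine forall_congr' fun k => ?_
    have h1 := hrank k
    have h2 := sum_range_removeCell hj k
    omega
  refine ⟨fun h => ?_, fun h => (hiff (by omega)).2 h.2⟩
  have hc : c (j + 1) < c j := by
    have h0 := h j
    have h1 := h (j + 1)
    have h2 := h (j + 1 + 1)
    rw [Finset.sum_range_succ] at h1
    rw [Finset.sum_range_succ, Finset.sum_range_succ] at h2
    have r0 := hrank j
    have r1 := hrank (j + 1)
    have r2 := hrank (j + 1 + 1)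
    rw [if_neg (lt_irrefl _)] at r0
    rw [if_pos (by omega)] at r1 r2
    have d1 := finrank_powRangeComap_add_rank B j
    have d2 := finrank_powRangeComap_add_rank B (j + 1)
    have d3 := Submodule.finrank_mono (powRangeComap_mono B (Nat.le_succ j))
    simp only [Nat.succ_eq_add_one] at d3
    omega
  exact ⟨hc, (hiff (by omega)).1 h⟩

theorem StrictUpper.exists_mem_powRangeComap_iff {B : Matrix (Fin m) (Fin m) F}
    (hB : StrictUpper B) (v : Fin m → F) : ∃ j ≤ m, ∀ k, v ∈ powRangeComap B k ↔ j ≤ k := by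
  classical
  have hm : v ∈ powRangeComap B m := by
    refine ⟨0, ?_⟩
    simp [hB.pow_eq_zero]
  refine ⟨Nat.find ⟨m, hm⟩, Nat.find_min' _ hm, fun k => ⟨fun h => Nat.find_min' _ h, fun h => ?_⟩⟩
  exact powRangeComap_mono B h (Nat.find_spec (⟨m, hm⟩ : ∃ k, v ∈ powRangeComap B k))

open scoped Classical in
/-- The number of columns `v` whose first membership among the `powRangeComap B k` is at `j`. -/
theorem card_filter_powRangeComap [Fintype F] {B : Matrix (Fin m) (Fin m) F} {c : ℕ → ℕ}
    (h : HasColumns B c) (j : ℕ) :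
    ((Finset.univ.filter fun v => ∀ k, v ∈ powRangeComap B k ↔ j ≤ k).card : ℤ) =
      (Fintype.card F : ℤ) ^ (m - c j) -
        if j = 0 then 0 else (Fintype.card F : ℤ) ^ (m - c (j - 1)) := by
  have hcard : ∀ k, (Finset.univ.filter fun v => v ∈ powRangeComap B k).card =
      Fintype.card F ^ (m - c k) := fun k => by
    rw [← Fintype.card_subtype, Module.card_eq_pow_finrank (K := F) (V := powRangeComap B k),
      Nat.eq_sub_of_add_eq (h.finrank_powRangeComap_add k)]
  cases j with
  | zero =>
    rw [if_pos rfl, sub_zero, ← Nat.cast_pow, ← hcard]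
    congr 2
    ext v
    simp only [Finset.mem_filter, Finset.mem_univ, true_and]
    exact ⟨fun h => (h 0).2 le_rfl, fun h k =>
      ⟨fun _ => Nat.zero_le _, fun _ => powRangeComap_mono B (Nat.zero_le k) h⟩⟩
  | succ j =>
    have hsub : (Finset.univ.filter fun v => v ∈ powRangeComap B j) ⊆
        Finset.univ.filter fun v => v ∈ powRangeComap B (j + 1) :=
      Finset.monotone_filter_right _ fun v _ hv => powRangeComap_mono B (Nat.le_succ j) hv
    rw [if_neg (Nat.succ_ne_zero j), Nat.add_sub_cancel, ← Nat.cast_pow, ← Nat.cast_pow, ← hcard,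
      ← hcard, ← Nat.cast_sub (Finset.card_le_card hsub), ← Finset.card_sdiff_of_subset hsub]
    congr 2
    ext v
    simp only [Finset.mem_filter, Finset.mem_univ, true_and, Finset.mem_sdiff]
    refine ⟨fun h => ⟨(h _).2 le_rfl, fun h' => ?_⟩, fun ⟨h1, h2⟩ k => ⟨fun hk => ?_, fun hk =>
      powRangeComap_mono B hk h1⟩⟩
    · have := (h _).1 h'
      omega
    · by_contra! hlt
      exact h2 (powRangeComap_mono B (Nat.lt_succ_iff.1 hlt) hk)

/-- The number of strictly upper triangular matrices with column lengths `c`. -/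
noncomputable def columnCount (m : ℕ) (c : ℕ → ℕ) (F : Type*) [Field F] : ℕ :=
  Nat.card {A : Matrix (Fin m) (Fin m) F // StrictUpper A ∧ HasColumns A c}

open scoped Classical in
theorem columnCount_eq_sum [Fintype F] (c : ℕ → ℕ) :
    (columnCount m c F : ℤ) = ∑ A : Matrix (Fin m) (Fin m) F,
      if StrictUpper A ∧ HasColumns A c then 1 else 0 := by
  rw [columnCount, Nat.card_eq_fintype_card, Fintype.card_subtype, Finset.sum_boole]

open scoped Classical in
theorem columnCount_succ [Fintype F] (c : ℕ → ℕ) :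
    (columnCount (m + 1) c F : ℤ) = ∑ j ∈ Finset.range (m + 1), if c (j + 1) < c j then
      ((Fintype.card F : ℤ) ^ (m - removeCell c j j) -
        if j = 0 then 0 else (Fintype.card F : ℤ) ^ (m - c (j - 1))) *
          columnCount m (removeCell c j) F else 0 := by
  have hpair : (columnCount (m + 1) c F : ℤ) =
      ∑ B : Matrix (Fin m) (Fin m) F, ∑ v : Fin m → F,
        if StrictUpper B ∧ HasColumns (borderColumn B v) c then 1 else 0 := by
    rw [columnCount_eq_sum, ← Fintype.sum_prod_type' (f := fun B v =>
      if StrictUpper B ∧ HasColumns (borderColumn B v) c then (1 : ℤ) else 0)]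
    symm
    refine Finset.sum_of_injOn (fun p => borderColumn p.1 p.2)
      borderColumn_injective.injOn (by simp) ?_ ?_
    · intro A _ hA
      refine if_neg fun h => hA ?_
      obtain ⟨p, rfl⟩ := exists_eq_borderColumn h.1
      exact ⟨p, by simp, rfl⟩
    · intro p _
      simp only [strictUpper_borderColumn_iff]
  have hpoint : ∀ (B : Matrix (Fin m) (Fin m) F) (v : Fin m → F),
      (if StrictUpper B ∧ HasColumns (borderColumn B v) c then (1 : ℤ) else 0) =
      ∑ j ∈ Finset.range (m + 1), if c (j + 1) < c j then
        (if StrictUpper B ∧ HasColumns B (removeCell c j) then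
          (if ∀ k, v ∈ powRangeComap B k ↔ j ≤ k then 1 else 0) else 0) else 0 := by
    intro B v
    by_cases hB : StrictUpper B
    swap
    · simp [hB]
    obtain ⟨j, hj, hv⟩ := hB.exists_mem_powRangeComap_iff v
    rw [Finset.sum_eq_single_of_mem j (by simpa using Nat.lt_succ_of_le hj)]
    · rw [hasColumns_borderColumn_iff hv, if_pos hv]
      simp only [hB, true_and]
      split_ifs <;> simp_all
    · intro i _ hij
      rw [if_neg (c := ∀ k, v ∈ powRangeComap B k ↔ i ≤ k)]
      · simp
      · intro hi
        have h1 := (hi j).1 ((hv j).2 le_rfl)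
        have h2 := (hv i).1 ((hi i).2 le_rfl)
        omega
  rw [hpair]
  simp_rw [hpoint]
  have hswap : ∀ B : Matrix (Fin m) (Fin m) F, ∀ G : (Fin m → F) → ℕ → ℤ,
      ∑ v : Fin m → F, ∑ j ∈ Finset.range (m + 1), G v j =
        ∑ j ∈ Finset.range (m + 1), ∑ v : Fin m → F, G v j := fun _ _ => Finset.sum_comm
  simp_rw [hswap 0]
  rw [Finset.sum_comm]
  refine Finset.sum_congr rfl fun j _ => ?_
  by_cases hc : c (j + 1) < c j
  swap
  · simp [hc]
  simp only [if_pos hc]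
  rw [columnCount_eq_sum, Finset.mul_sum]
  refine Finset.sum_congr rfl fun B _ => ?_
  by_cases hB : StrictUpper B ∧ HasColumns B (removeCell c j)
  swap
  · simp [hB]
  simp only [if_pos hB, mul_one, Finset.sum_boole]
  rw [card_filter_powRangeComap hB.2]
  congr 1
  refine if_ctx_congr Iff.rfl (fun _ => rfl) fun hj => ?_
  rw [removeCell, Function.update_of_ne (by omega)]

theorem columnCount_eq_eval [Fintype F] {c : ℕ → ℕ} (h : IsColumnFun c m) :
    (columnCount m c F : ℤ) =
      ((Fintype.card F : ℤ) - 1) ^ (m - c 0) * (columnPolyInt m c).eval (Fintype.card F : ℤ) := by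
  classical
  induction m generalizing c with
  | zero =>
    have h0 : ∀ i, c i = 0 := fun i => h.apply_eq_zero (Nat.zero_le _)
    have h1 : ∀ A : Matrix (Fin 0) (Fin 0) F, StrictUpper A ∧ HasColumns A c := fun A =>
      ⟨fun i => i.elim0, fun k => by
        simpa [h0] using Matrix.rank_le_width (A ^ k)⟩
    rw [columnCount_eq_sum]
    simp [h1, columnPolyInt, columnPoly, Fintype.card_eq_one_iff]
    exact ⟨0, fun A => Subsingleton.elim _ _⟩
  | succ m ih =>
    rw [columnCount_succ, h.columnPolyInt_succ le_rfl, eval_finsetSum, Finset.mul_sum]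
    refine Finset.sum_congr rfl fun j hj => ?_
    by_cases hc : c (j + 1) < c j
    swap
    · simp [hc]
    rw [if_pos hc, if_pos hc, ih (h.removeCell hc), eval_mul]
    cases j with
    | zero =>
      have e1 : m - (c 0 - 1) = m + 1 - c 0 := by omega
      simp [removeCell, cellWeightInt_zero, e1]
      ring
    | succ j =>
      have hjj := h.add_le j (j + 1) (Nat.lt_succ_self j)
      have h0j := h.add_le 0 (j + 1) (Nat.succ_pos j)
      have e1 : m - (c (j + 1) - 1) = m - c j + (c j - c (j + 1) + 1) := by
        have := h.1 (Nat.le_succ j)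
        simp only [Nat.succ_eq_add_one] at this
        omega
      have e2 : removeCell c (j + 1) 0 = c 0 := by simp [removeCell]
      have e3 : removeCell c (j + 1) (j + 1) = c (j + 1) - 1 := by simp [removeCell]
      rw [if_neg (Nat.succ_ne_zero j), cellWeightInt_succ, e2, e3, e1, Nat.add_sub_cancel,
        show m + 1 - c 0 = m - c 0 + 1 by omega]
      have hg := mul_geom_sum (Fintype.card F : ℤ) (c j - c (j + 1) + 1)
      simp only [eval_mul, eval_pow, eval_X, eval_finsetSum]
      rw [pow_add, pow_succ (_ - 1)]
      linear_combination (-(Fintype.card F : ℤ) ^ (m - c j) *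
        ((Fintype.card F : ℤ) - 1) ^ (m - c 0) *
        (columnPolyInt m (removeCell c (j + 1))).eval (Fintype.card F : ℤ)) * hg

end Matrices

theorem sum_range_dualPart (f : ℕ → ℕ) (N k : ℕ) :
    ∑ j ∈ Finset.range k, dualPart f N (j + 1) = ∑ i ∈ Finset.Icc 1 N, min (f i) k := by
  induction k with
  | zero => simp
  | succ k ih =>
    rw [Finset.sum_range_succ, ih, dualPart, Finset.card_filter, ← Finset.sum_add_distrib]
    refine Finset.sum_congr rfl fun i _ => ?_
    split_ifs <;> omega

namespace IsPartitionFun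

variable {f : ℕ → ℕ} {n N : ℕ}

theorem isColumnFun (h : IsPartitionFun f n N) :
    IsColumnFun (fun j => dualPart f N (j + 1)) n := by
  refine ⟨fun i j hij => Finset.card_le_card fun x hx => ?_, n, fun M hM => ?_⟩
  · rw [Finset.mem_filter] at hx ⊢
    exact ⟨hx.1, by omega⟩
  · rw [sum_range_dualPart, ← h.2.2]
    refine Finset.sum_congr rfl fun i hi => min_eq_left ?_
    have := Finset.single_le_sum (f := f) (fun _ _ => Nat.zero_le _) hi
    rw [h.2.2] at this
    omega

theorem hasJordanType_iff (h : IsPartitionFun f n N) {F : Type*} [Field F]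
    {A : Matrix (Fin n) (Fin n) F} :
    HasJordanType A f N ↔ HasColumns A fun j => dualPart f N (j + 1) := by
  refine forall_congr' fun k => ?_
  have h1 : ∑ i ∈ Finset.Icc 1 N, (f i - k) + ∑ i ∈ Finset.Icc 1 N, min (f i) k = n := by
    rw [← Finset.sum_add_distrib, ← h.2.2]
    exact Finset.sum_congr rfl fun i _ => by omega
  rw [sum_range_dualPart]
  omega

theorem jordanCount_eq (h : IsPartitionFun f n N) (F : Type) [Field F] [Fintype F] :
    jordanCount n f N F = columnCount n (fun j => dualPart f N (j + 1)) F := by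
  simp only [jordanCount, columnCount, h.hasJordanType_iff]

theorem eq_of_forall_jordanCount_eq (h : IsPartitionFun f n N) {P : ℤ[X]}
    (hP : ∀ (F : Type) [Field F] [Fintype F],
      (jordanCount n f N F : ℤ) = P.eval (Fintype.card F : ℤ)) :
    P = (X - 1) ^ (n - dualPart f N 1) * columnPolyInt n fun j => dualPart f N (j + 1) := by
  refine eq_of_infinite_eval_eq _ _ ((Nat.infinite_setOfPred_prime.image
    (Nat.cast_injective (R := ℤ)).injOn).mono ?_)
  rintro _ ⟨p, hp, rfl⟩
  have : Fact p.Prime := ⟨hp⟩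
  have h1 := hP (ZMod p)
  rw [h.jordanCount_eq, columnCount_eq_eval h.isColumnFun, ZMod.card] at h1
  simp [← h1]

end IsPartitionFun

theorem dualPart_one_sub_dualPart_two (f : ℕ → ℕ) (N : ℕ) :
    dualPart f N 1 - dualPart f N 2 = alphaCount f N 1 := by
  have h1 : dualPart f N 1 = alphaCount f N 1 + dualPart f N 2 := by
    simp only [dualPart, alphaCount, Finset.card_filter, ← Finset.sum_add_distrib]
    refine Finset.sum_congr rfl fun i _ => ?_
    split_ifs <;> omega
  omega

theorem dualPart_succ_eq_addRow {f g : ℕ → ℕ} {N : ℕ} (hgf : ∀ i, 1 ≤ i → i ≤ N → g i = f i)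
    (hgN : g (N + 1) = 1) :
    (fun j => dualPart g (N + 1) (j + 1)) = addRow fun j => dualPart f N (j + 1) := by
  ext j
  have h : ∑ i ∈ Finset.Icc 1 N, (if j + 1 ≤ g i then 1 else 0) =
      ∑ i ∈ Finset.Icc 1 N, (if j + 1 ≤ f i then 1 else 0) :=
    Finset.sum_congr rfl fun i hi => by
      rw [Finset.mem_Icc] at hi
      rw [hgf i hi.1 hi.2]
  simp only [dualPart, addRow, Finset.card_filter, Function.update_apply]
  rw [Finset.sum_Icc_succ_top (by omega), h, hgN]
  cases j <;> simp

theorem eq_of_X_sub_one_pow_mul_eq {p q : ℤ[X]} {a b : ℕ}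
    (h : (X - 1) ^ a * p = (X - 1) ^ b * q) (hp : p.eval 1 ≠ 0) (hq : q.eval 1 ≠ 0) :
    p = q := by
  have hX : (X - 1 : ℤ[X]) ≠ 0 := X_sub_C_ne_zero 1
  wlog hab : a ≤ b generalizing a b p q
  · exact (this h.symm hq hp (le_of_not_ge hab)).symm
  obtain ⟨k, rfl⟩ := Nat.exists_eq_add_of_le hab
  rw [pow_add, mul_assoc] at h
  have h1 := mul_left_cancel₀ (pow_ne_zero a hX) h
  cases k with
  | zero => simpa using h1
  | succ k => simp [h1] at hp

theorem columnPolyInt_eval_one_ne_zero {c : ℕ → ℕ} {m : ℕ} (h : IsColumnFun c m) :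
    (columnPolyInt m c).eval 1 ≠ 0 := by
  have := columnPoly_eval_one_pos h
  rw [columnPolyInt, eval_one_map]
  simp
  omega

theorem IsPartitionFun.columnPolyInt_eq {f : ℕ → ℕ} {n N d e : ℕ} (h : IsPartitionFun f n N)
    {P R : ℤ[X]} (hP : ∀ (F : Type) [Field F] [Fintype F],
      (jordanCount n f N F : ℤ) = P.eval (Fintype.card F : ℤ))
    (hfac : P = X ^ d * (X - 1) ^ e * R) (hR : R.eval 1 ≠ 0) :
    columnPolyInt n (fun j => dualPart f N (j + 1)) = X ^ d * R := by
  have h1 := h.eq_of_forall_jordanCount_eq hP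
  rw [hfac, mul_comm (X ^ d), mul_assoc] at h1
  exact eq_of_X_sub_one_pow_mul_eq h1.symm (columnPolyInt_eval_one_ne_zero h.isColumnFun)
    (by simpa using hR)

theorem X_pow_dvd_sub_of_X_pow_dvd_X_pow_mul_sub {p q : ℤ[X]} {a b k : ℕ}
    (h : X ^ (b + k + 1) ∣ X ^ a * p - X ^ b * q) (hp : p.eval 0 ≠ 0) (hq : q.eval 0 ≠ 0) :
    X ^ (k + 1) ∣ p - q := by
  have hab : a = b := by
    have hc := X_pow_dvd_iff.1 h
    rw [← coeff_zero_eq_eval_zero] at hp hq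
    rcases lt_trichotomy a b with hlt | heq | hgt
    · have := hc a (by omega)
      rw [coeff_sub, coeff_X_pow_mul', coeff_X_pow_mul', if_pos le_rfl, if_neg (by omega)] at this
      simp_all
    · exact heq
    · have := hc b (by omega)
      rw [coeff_sub, coeff_X_pow_mul', coeff_X_pow_mul', if_pos le_rfl, if_neg (by omega)] at this
      simp_all
  subst hab
  rw [← mul_sub, add_assoc, pow_add] at h
  exact (mul_dvd_mul_iff_left (pow_ne_zero _ X_ne_zero)).1 h

theorem R_stabilization_step (n N : ℕ) (f g : ℕ → ℕ)
    (hf : IsPartitionFun f n N) (hg : IsPartitionFun g (n + 1) (N + 1))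
    (hgf : ∀ i, 1 ≤ i → i ≤ N → g i = f i) (hgN : g (N + 1) = 1)
    (P : Polynomial ℤ)
    (hP : ∀ (F : Type) [Field F] [Fintype F],
      (jordanCount n f N F : ℤ) = P.eval (Fintype.card F : ℤ))
    (d e : ℕ) (R : Polynomial ℤ)
    (hfac : P = X ^ d * (X - 1) ^ e * R)
    (hR0 : R.eval 0 ≠ 0) (hR1 : R.eval 1 ≠ 0)
    (P₂ : Polynomial ℤ)
    (hP₂ : ∀ (F : Type) [Field F] [Fintype F],
      (jordanCount (n + 1) g (N + 1) F : ℤ) = P₂.eval (Fintype.card F : ℤ))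
    (d₂ e₂ : ℕ) (R₂ : Polynomial ℤ)
    (hfac₂ : P₂ = X ^ d₂ * (X - 1) ^ e₂ * R₂)
    (hR₂0 : R₂.eval 0 ≠ 0) (hR₂1 : R₂.eval 1 ≠ 0) :
    (X : Polynomial ℤ) ^ (alphaCount f N 1 + 1) ∣ R₂ - R := by
  have hQ := hf.columnPolyInt_eq hP hfac hR1
  have hQ₂ := hg.columnPolyInt_eq hP₂ hfac₂ hR₂1
  rw [dualPart_succ_eq_addRow hgf hgN] at hQ₂
  have hdvd := X_pow_dvd_columnPolyInt_addRow_sub hf.isColumnFun d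
    (X_pow_dvd_map_intCast.1 ⟨R, hQ⟩)
  rw [hQ, hQ₂, ← mul_assoc, ← pow_add, zero_add, dualPart_one_sub_dualPart_two] at hdvd
  exact X_pow_dvd_sub_of_X_pow_dvd_X_pow_mul_sub hdvd hR₂0 hR0
end

section
/- Let i₁ > i₂ > … > i_r > 1 be integers and let λ = (i₁, i₂, …, i_r) be the partition with these (pairwise distinct) parts; put M = i₁ + i₂ + … + i_r. For k ≥ 0 let λ1^k be the partition obtained from λ by appending k parts equal to 1. Then for every m ≥ 0 there exists K such that for all k ≥ K the coefficient of x^m in R_{λ1^k}(x) · (1−x)^{M} equals 1 if m = 0 and 0 if m ≥ 1; that is, the limit power series R_{λ1^∞} equals 1/(1−x)^{i₁+…+i_r}. -/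
open Polynomial

/-- The partition `λ1^k` obtained from `λ` (with `N` parts) by appending `k` parts
equal to `1`. -/
def extendOnes (f : ℕ → ℕ) (N k : ℕ) : ℕ → ℕ :=
  fun i => if i ≤ N then f i else if i ≤ N + k then 1 else 0

namespace JordanCount

section LinearAlgebra

variable {F : Type} [Field F] {n : ℕ}

/-- `A` has column shape `c`: the Young diagram of its Jordan type has columns of lengths
`c 0, c 1, …`. -/
def HasColumns (A : Matrix (Fin n) (Fin n) F) (c : ℕ → ℕ) : Prop :=
  ∀ k, (A ^ k).rank = (A ^ (k + 1)).rank + c k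

/-- The subspace `ker A ^ j + im A`, described as the preimage of `im A ^ (j + 1)` under `A ^ j`. -/
def growth (A : Matrix (Fin n) (Fin n) F) (j : ℕ) : Submodule F (Fin n → F) :=
  (A ^ (j + 1)).mulVecLin.range.comap (A ^ j).mulVecLin

theorem growth_le_succ (A : Matrix (Fin n) (Fin n) F) (j : ℕ) : growth A j ≤ growth A (j + 1) := by
  rintro v ⟨u, hu⟩
  refine ⟨u, ?_⟩
  simp only [Matrix.mulVecLin_apply] at hu ⊢
  rw [pow_succ' A (j + 1), ← Matrix.mulVec_mulVec, hu, pow_succ' A j, Matrix.mulVec_mulVec]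

theorem growth_mono (A : Matrix (Fin n) (Fin n) F) : Monotone (growth A) :=
  monotone_nat_of_le_succ (growth_le_succ A)

theorem finrank_comap_add_rank {V W : Type*} [AddCommGroup V] [Module F V] [Module.Finite F V]
    [AddCommGroup W] [Module F W] [Module.Finite F W]
    (f : V →ₗ[F] W) (p : Submodule F W) (hp : p ≤ f.range) :
    Module.finrank F (p.comap f) + Module.finrank F f.range
      = Module.finrank F V + Module.finrank F p := by
  have h1 := (f.domRestrict (p.comap f)).finrank_range_add_finrank_ker
  have h2 := f.finrank_range_add_finrank_ker
  have h3 : (f.domRestrict (p.comap f)).range = p := by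
    rw [LinearMap.range_domRestrict, Submodule.map_comap_eq, inf_eq_right.2 hp]
  have h4 : Module.finrank F (f.domRestrict (p.comap f)).ker = Module.finrank F f.ker := by
    rw [LinearMap.ker_domRestrict, ← Submodule.finrank_map_subtype_eq,
      Submodule.map_comap_subtype, inf_eq_right.2]
    exact LinearMap.ker_le_comap f
  rw [h3, h4] at h1
  omega

theorem range_pow_succ_le (A : Matrix (Fin n) (Fin n) F) (j : ℕ) :
    (A ^ (j + 1)).mulVecLin.range ≤ (A ^ j).mulVecLin.range := by
  rintro _ ⟨u, rfl⟩
  exact ⟨A.mulVec u, by simp [pow_succ]⟩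

theorem HasColumns.finrank_growth {A : Matrix (Fin n) (Fin n) F} {c : ℕ → ℕ}
    (hA : HasColumns A c) (j : ℕ) : Module.finrank F (growth A j) + c j = n := by
  have h := finrank_comap_add_rank (A ^ j).mulVecLin _ (range_pow_succ_le A j)
  have h2 : Module.finrank F (A ^ j).mulVecLin.range
    = Module.finrank F (A ^ (j + 1)).mulVecLin.range + c j := hA j
  rw [Module.finrank_fin_fun] at h
  unfold growth
  omega

theorem HasColumns.antitone {A : Matrix (Fin n) (Fin n) F} {c : ℕ → ℕ}
    (hA : HasColumns A c) : Antitone c := by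
  refine antitone_nat_of_succ_le fun j => ?_
  have h1 := hA.finrank_growth j
  have h2 := hA.finrank_growth (j + 1)
  have h3 := Submodule.finrank_mono (growth_le_succ A j)
  omega

/-- The matrix obtained from `A` by appending the column `v` and a zero row. -/
def appendColumn (A : Matrix (Fin n) (Fin n) F) (v : Fin n → F) :
    Matrix (Fin (n + 1)) (Fin (n + 1)) F :=
  Matrix.reindexAlgEquiv F F finSumFinEquiv
    (Matrix.fromBlocks A (Matrix.replicateCol (Fin 1) v) 0 0)

theorem fromBlocks_column_pow (A : Matrix (Fin n) (Fin n) F) (v : Fin n → F) (k : ℕ) :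
    (Matrix.fromBlocks A (Matrix.replicateCol (Fin 1) v) 0 0 :
      Matrix (Fin n ⊕ Fin 1) (Fin n ⊕ Fin 1) F) ^ (k + 1) =
      Matrix.fromBlocks (A ^ (k + 1)) (Matrix.replicateCol (Fin 1) ((A ^ k).mulVec v)) 0 0 := by
  induction k with
  | zero => simp
  | succ k ih =>
    rw [pow_succ', ih, Matrix.fromBlocks_multiply]
    simp only [Matrix.mul_zero, Matrix.zero_mul, add_zero, ← pow_succ']
    rw [← Matrix.replicateCol_mulVec, Matrix.mulVec_mulVec, ← pow_succ']

theorem rank_fromBlocks_column (A : Matrix (Fin n) (Fin n) F) (w : Fin n → F) :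
    (Matrix.fromBlocks A (Matrix.replicateCol (Fin 1) w) 0 0 :
      Matrix (Fin n ⊕ Fin 1) (Fin n ⊕ Fin 1) F).rank
      = Module.finrank F ↥(A.mulVecLin.range ⊔ Submodule.span F {w}) := by
  let ι : (Fin n → F) →ₗ[F] (Fin n ⊕ Fin 1 → F) :=
    { toFun := fun u => Sum.elim u 0
      map_add' := fun x y => by ext i; cases i <;> simp
      map_smul' := fun a x => by ext i; cases i <;> simp }
  have hι : Function.Injective ι := fun x y h => by
    ext i
    exact congrFun h (Sum.inl i)
  rw [(Submodule.equivMapOfInjective ι hι _).finrank_eq]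
  suffices h : (Matrix.fromBlocks A (Matrix.replicateCol (Fin 1) w) 0 0 :
      Matrix (Fin n ⊕ Fin 1) (Fin n ⊕ Fin 1) F).mulVecLin.range
      = (A.mulVecLin.range ⊔ Submodule.span F {w}).map ι by rw [← h, Matrix.rank]
  ext x
  simp only [LinearMap.mem_range, Matrix.mulVecLin_apply, Submodule.mem_map, Submodule.mem_sup,
    Submodule.mem_span_singleton]
  constructor
  · rintro ⟨u, rfl⟩
    refine ⟨_, ⟨_, ⟨u ∘ Sum.inl, rfl⟩, _, ⟨u (Sum.inr 0), rfl⟩, rfl⟩, ?_⟩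
    rw [Matrix.fromBlocks_mulVec]
    ext i
    rcases i with i | i <;> simp [ι, Matrix.mulVec, dotProduct, mul_comm]
  · rintro ⟨_, ⟨_, ⟨u, rfl⟩, _, ⟨a, rfl⟩, rfl⟩, rfl⟩
    refine ⟨Sum.elim u fun _ => a, ?_⟩
    rw [Matrix.fromBlocks_mulVec]
    ext i
    rcases i with i | i <;> simp [ι, Matrix.mulVec, dotProduct, mul_comm]

open Classical in
theorem rank_appendColumn_pow_succ (A : Matrix (Fin n) (Fin n) F) (v : Fin n → F) (k : ℕ) :
    (appendColumn A v ^ (k + 1)).rank = (A ^ (k + 1)).rank + if v ∈ growth A k then 0 else 1 := by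
  unfold appendColumn
  rw [← map_pow, fromBlocks_column_pow, Matrix.coe_reindexAlgEquiv, Matrix.rank_reindex,
    rank_fromBlocks_column]
  have hmem : v ∈ growth A k ↔ (A ^ k).mulVec v ∈ (A ^ (k + 1)).mulVecLin.range := Iff.rfl
  split_ifs with h
  · rw [sup_eq_left.2 ((Submodule.span_singleton_le_iff_mem _ _).2 (hmem.1 h)), add_zero]
    rfl
  · rw [Submodule.finrank_sup_span_singleton (mt hmem.2 h)]
    rfl

/-- Appending the column `v` adds a box to the `j`-th column of the Young diagram. -/
def AddsBox (A : Matrix (Fin n) (Fin n) F) (v : Fin n → F) (j : ℕ) : Prop :=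
  v ∈ growth A j ∧ ∀ i < j, v ∉ growth A i

theorem AddsBox.rank_pow {A : Matrix (Fin n) (Fin n) F} {v : Fin n → F} {j : ℕ}
    (h : AddsBox A v j) (k : ℕ) :
    (appendColumn A v ^ k).rank = (A ^ k).rank + if k ≤ j then 1 else 0 := by
  classical
  cases k with
  | zero => simp
  | succ k =>
    rw [rank_appendColumn_pow_succ]
    by_cases hk : k < j
    · rw [if_neg (h.2 k hk), if_pos (Nat.succ_le_of_lt hk)]
    · rw [if_pos (growth_mono A (not_lt.1 hk) h.1), if_neg (by omega)]

theorem AddsBox.hasColumns_iff {A : Matrix (Fin n) (Fin n) F} {v : Fin n → F} {j : ℕ}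
    (h : AddsBox A v j) (c : ℕ → ℕ) :
    HasColumns (appendColumn A v) c ↔ 1 ≤ c j ∧ HasColumns A (c - Pi.single j 1) := by
  unfold HasColumns
  simp only [h.rank_pow, Pi.sub_apply]
  constructor
  · intro H
    have hj := H j
    have hle := Submodule.finrank_mono (range_pow_succ_le A j)
    change (A ^ (j + 1)).rank ≤ (A ^ j).rank at hle
    rw [if_pos le_rfl, if_neg (by omega)] at hj
    refine ⟨by omega, fun k => ?_⟩
    have hk := H k
    by_cases hkj : k = j
    · subst hkj
      simp
      omega
    · rw [Pi.single_eq_of_ne hkj]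
      split_ifs at hk <;> omega
  · rintro ⟨hj, H⟩ k
    have hk := H k
    by_cases hkj : k = j
    · subst hkj
      simp at hk ⊢
      omega
    · rw [Pi.single_eq_of_ne hkj] at hk
      split_ifs <;> omega

theorem AddsBox.unique {A : Matrix (Fin n) (Fin n) F} {v : Fin n → F} {i j : ℕ}
    (hi : AddsBox A v i) (hj : AddsBox A v j) : i = j := by
  by_contra hne
  rcases lt_or_gt_of_ne hne with h | h
  · exact hj.2 i h hi.1
  · exact hi.2 j h hj.1

theorem HasColumns.rank_pow_add_sum {A : Matrix (Fin n) (Fin n) F} {c : ℕ → ℕ}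
    (hA : HasColumns A c) (k : ℕ) : (A ^ k).rank + ∑ j ∈ Finset.range k, c j = n := by
  induction k with
  | zero => simp
  | succ k ih =>
    rw [Finset.sum_range_succ]
    have := hA k
    omega

theorem exists_addsBox {A : Matrix (Fin n) (Fin n) F} {v : Fin n → F} {c : ℕ → ℕ} {L : ℕ}
    (hsum : ∑ j ∈ Finset.range L, c j = n + 1) (h : HasColumns (appendColumn A v) c) :
    ∃ j < L, AddsBox A v j := by
  classical
  cases L with
  | zero => simp at hsum
  | succ L =>
    have h1 := h.rank_pow_add_sum (L + 1)
    rw [rank_appendColumn_pow_succ] at h1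
    have hv : v ∈ growth A L := by
      by_contra hv
      rw [if_neg hv] at h1
      omega
    have hex : ∃ j, v ∈ growth A j := ⟨L, hv⟩
    exact ⟨Nat.find hex, Nat.lt_succ_of_le (Nat.find_le hv), Nat.find_spec hex,
      fun i hi => Nat.find_min hex hi⟩

/-- The number of columns that add a box to the `j`-th column of the shape `c` of size `n`, over
a field with `q` elements. -/
def boxWeight (q : ℤ) (n : ℕ) (c : ℕ → ℕ) : ℕ → ℤ
  | 0 => q ^ (n - c 0)
  | j + 1 => q ^ (n - c (j + 1)) - q ^ (n - c j)

theorem HasColumns.card_addsBox [Fintype F] {A : Matrix (Fin n) (Fin n) F} {c : ℕ → ℕ}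
    (hA : HasColumns A c) (j : ℕ) :
    (Nat.card {v // AddsBox A v j} : ℤ) = boxWeight (Fintype.card F) n c j := by
  classical
  have key : ∀ i, (Nat.card (growth A i) : ℤ) = (Fintype.card F : ℤ) ^ (n - c i) := fun i => by
    rw [Module.natCard_eq_pow_finrank (K := F), Nat.card_eq_fintype_card,
      Nat.eq_sub_of_add_eq (hA.finrank_growth i)]
    push_cast
    rfl
  cases j with
  | zero =>
    rw [boxWeight, ← key 0]
    congr 1
    exact Nat.card_congr (Equiv.subtypeEquivRight fun v => by simp [AddsBox])
  | succ j =>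
    rw [boxWeight, ← key, ← key, eq_sub_iff_add_eq, ← Nat.cast_add]
    congr 1
    have hiff : ∀ v, AddsBox A v (j + 1) ↔ v ∈ growth A (j + 1) ∧ v ∉ growth A j := fun v =>
      and_congr_right fun _ => ⟨fun h => h j (by omega),
        fun h i hi hv => h (growth_mono A (by omega) hv)⟩
    rw [Nat.card_congr (Equiv.subtypeEquivRight hiff)]
    exact Set.ncard_sdiff_add_ncard_of_subset (growth_le_succ A j)

theorem strictUpper_appendColumn (A : Matrix (Fin n) (Fin n) F) (v : Fin n → F) :
    StrictUpper (appendColumn A v) ↔ StrictUpper A := by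
  have hcc : ∀ i j : Fin n, appendColumn A v i.castSucc j.castSucc = A i j := fun i j => by
    have h : ∀ i : Fin n, finSumFinEquiv.symm i.castSucc = (Sum.inl i : Fin n ⊕ Fin 1) :=
      fun i => finSumFinEquiv_symm_apply_castAdd i
    simp [appendColumn, h]
  have hlast : ∀ j, appendColumn A v (Fin.last n) j = 0 := fun j => by
    simp only [appendColumn, Matrix.coe_reindexAlgEquiv, Matrix.reindex_apply,
      Matrix.submatrix_apply, finSumFinEquiv_symm_last]
    rcases finSumFinEquiv.symm j with i | i <;> rfl
  constructor
  · intro h i j hij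
    rw [← hcc]
    exact h _ _ hij
  · intro h i j hij
    induction i using Fin.lastCases with
    | last => exact hlast j
    | cast i =>
      induction j using Fin.lastCases with
      | last =>
        simp at hij
        omega
      | cast j =>
        rw [hcc]
        exact h i j hij

theorem appendColumn_injective :
    Function.Injective fun p : Matrix (Fin n) (Fin n) F × (Fin n → F) =>
      appendColumn p.1 p.2 := by
  rintro ⟨A, v⟩ ⟨A', v'⟩ h
  have h' := (Matrix.reindexAlgEquiv F F finSumFinEquiv).injective h
  rw [Matrix.fromBlocks_inj] at h'
  exact Prod.ext h'.1 (Matrix.replicateCol_injective h'.2.1)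

theorem StrictUpper.exists_appendColumn {B : Matrix (Fin (n + 1)) (Fin (n + 1)) F}
    (hB : StrictUpper B) : ∃ A v, appendColumn A v = B := by
  refine ⟨B.submatrix Fin.castSucc Fin.castSucc, fun i => B i.castSucc (Fin.last n), ?_⟩
  apply (Matrix.reindexAlgEquiv F F finSumFinEquiv).symm.injective
  unfold appendColumn
  rw [AlgEquiv.symm_apply_apply]
  ext i j
  have hl : ∀ j : Fin 1, Fin.natAdd n j = Fin.last n := fun j => by
    rw [Subsingleton.elim j 0]
    rfl
  rcases i with i | i <;> rcases j with j | j
  · simp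
    rfl
  · simp [hl]
    rfl
  · simp [hl]
    exact (hB _ _ (Fin.le_last _)).symm
  · simp [hl]
    exact (hB _ _ le_rfl).symm

/-- The number of strictly upper triangular `n × n` matrices of column shape `c`. -/
noncomputable def columnCount (F : Type) [Field F] (n : ℕ) (c : ℕ → ℕ) : ℕ :=
  Nat.card {A : Matrix (Fin n) (Fin n) F // StrictUpper A ∧ HasColumns A c}

theorem columnCount_succ [Fintype F] {L : ℕ} {c : ℕ → ℕ}
    (hsum : ∑ j ∈ Finset.range L, c j = n + 1) :
    (columnCount F (n + 1) c : ℤ) = ∑ j ∈ Finset.range L,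
      if 1 ≤ c j then
        boxWeight (Fintype.card F) n (c - Pi.single j 1) j * columnCount F n (c - Pi.single j 1)
      else 0 := by
  classical
  have hpairs : columnCount F (n + 1) c =
      Nat.card {p : Matrix (Fin n) (Fin n) F × (Fin n → F) //
        StrictUpper p.1 ∧ HasColumns (appendColumn p.1 p.2) c} := by
    refine (Nat.card_eq_of_bijective (fun p => ⟨appendColumn p.1.1 p.1.2,
      (strictUpper_appendColumn _ _).2 p.2.1, p.2.2⟩) ⟨?_, ?_⟩).symm
    · intro p p' h
      exact Subtype.ext (appendColumn_injective (Subtype.ext_iff.1 h))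
    · rintro ⟨B, hB, hc⟩
      obtain ⟨A, v, rfl⟩ := StrictUpper.exists_appendColumn hB
      exact ⟨⟨(A, v), (strictUpper_appendColumn _ _).1 hB, hc⟩, rfl⟩
  have hsplit : ∀ (A : Matrix (Fin n) (Fin n) F) (v : Fin n → F),
      (if HasColumns (appendColumn A v) c then (1 : ℤ) else 0) =
      ∑ j ∈ Finset.range L, if 1 ≤ c j ∧ HasColumns A (c - Pi.single j 1) ∧ AddsBox A v j
        then 1 else 0 := fun A v => by
    split_ifs with h
    · obtain ⟨j, hj, hA⟩ := exists_addsBox hsum h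
      rw [Finset.sum_eq_single_of_mem j (Finset.mem_range.2 hj), if_pos]
      · obtain ⟨h1, h2⟩ := (hA.hasColumns_iff c).1 h
        exact ⟨h1, h2, hA⟩
      · rintro i - hij
        exact if_neg fun hi => hij (hi.2.2.unique hA)
    · refine (Finset.sum_eq_zero fun j _ => if_neg ?_).symm
      rintro ⟨h1, h2, hA⟩
      exact h ((hA.hasColumns_iff c).2 ⟨h1, h2⟩)
  have hcard : ∀ (A : Matrix (Fin n) (Fin n) F) (j : ℕ), HasColumns A (c - Pi.single j 1) →
      ∑ v, (if AddsBox A v j then (1 : ℤ) else 0)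
        = boxWeight (Fintype.card F) n (c - Pi.single j 1) j := fun A j hA => by
    rw [← hA.card_addsBox, Nat.card_eq_fintype_card, Fintype.card_subtype, Finset.sum_boole]
  rw [hpairs, Nat.card_eq_fintype_card, Fintype.card_subtype, ← Finset.sum_boole,
    Fintype.sum_prod_type]
  simp only [ite_and, hsplit]
  calc _ = ∑ A : Matrix (Fin n) (Fin n) F, ∑ j ∈ Finset.range L, if 1 ≤ c j then
          if StrictUpper A ∧ HasColumns A (c - Pi.single j 1) then
            boxWeight (Fintype.card F) n (c - Pi.single j 1) j else 0 else 0 := by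
        refine Finset.sum_congr rfl fun A _ => ?_
        by_cases hA : StrictUpper A
        · simp only [hA, if_true, true_and]
          rw [Finset.sum_comm]
          refine Finset.sum_congr rfl fun j _ => ?_
          by_cases hj : 1 ≤ c j
          · by_cases hc : HasColumns A (c - Pi.single j 1)
            · simp only [hj, hc, if_true, hcard]
            · simp [hc]
          · simp [hj]
        · simp [hA]
    _ = _ := by
        rw [Finset.sum_comm]
        refine Finset.sum_congr rfl fun j _ => ?_
        by_cases hj : 1 ≤ c j
        · simp only [hj, if_true]
          rw [columnCount, Nat.card_eq_fintype_card, Fintype.card_subtype, ← Finset.sum_boole,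
            Finset.mul_sum]
          simp
        · simp [hj]

end LinearAlgebra

section Recursion

/-- `c` is the sequence of column lengths of a Young diagram of size `n` with at most `L`
columns. -/
structure IsShape (L n : ℕ) (c : ℕ → ℕ) : Prop where
  antitone : Antitone c
  eq_zero : ∀ j, L ≤ j → c j = 0
  sum_eq : ∑ j ∈ Finset.range L, c j = n

/-- The polynomial `(1 - x) (1 - x ^ 2) ⋯ (1 - x ^ n)`. -/
noncomputable def qPoch (n : ℕ) : ℤ[X] := ∏ i ∈ Finset.range n, (1 - X ^ (i + 1))

theorem qPoch_succ (n : ℕ) : qPoch (n + 1) = qPoch n * (1 - X ^ (n + 1)) :=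
  Finset.prod_range_succ _ n

/-- Up to a power of `1 - x`, the polynomial counting the complete flags stabilized by a nilpotent
matrix whose Jordan type has the column lengths `c`. -/
noncomputable def flagPoly (L : ℕ) : ℕ → (ℕ → ℕ) → ℤ[X]
  | 0, _ => 1
  | n + 1, c =>
    ∑ j ∈ Finset.range L, (X ^ c (j + 1) - X ^ c j) * flagPoly L n (c - Pi.single j 1)

variable {L n : ℕ} {c : ℕ → ℕ}

theorem IsShape.exists_eq_add_single (h : IsShape L (n + 1) c) {j : ℕ} (hj : j < L)
    (hc : c (j + 1) < c j) : ∃ b, IsShape L n b ∧ c = b + Pi.single j 1 := by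
  have hc' : c = (c - Pi.single j 1) + Pi.single j 1 := by
    funext i
    by_cases hi : i = j
    · subst hi
      simp
      omega
    · simp [Pi.single_eq_of_ne hi]
  refine ⟨c - Pi.single j 1, ⟨?_, ?_, ?_⟩, hc'⟩
  · refine antitone_nat_of_succ_le fun i => ?_
    have h1 := h.antitone (Nat.le_succ i)
    simp only [Pi.sub_apply, Pi.single_apply]
    split_ifs <;> subst_vars <;> simp at * <;> omega
  · intro i hi
    simp [h.eq_zero i hi]
  · have := h.sum_eq
    rw [hc'] at this
    simp only [Pi.add_apply, Finset.sum_add_distrib] at this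
    rw [Finset.sum_pi_single', if_pos (Finset.mem_range.2 hj)] at this
    omega

/-- It suffices to consider the corners of a Young diagram. -/
theorem flagPoly_succ_eq_sum_corners (h : IsShape L (n + 1) c) :
    flagPoly L (n + 1) c = ∑ j ∈ Finset.range L with c (j + 1) < c j,
      (X ^ c (j + 1) - X ^ c j) * flagPoly L n (c - Pi.single j 1) := by
  rw [flagPoly, Finset.sum_filter]
  refine Finset.sum_congr rfl fun j _ => ?_
  split_ifs with hj
  · rfl
  · rw [le_antisymm (not_lt.1 hj) (h.antitone (Nat.le_succ j)), sub_self, zero_mul]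

theorem IsShape.exists_corner (h : IsShape L (n + 1) c) : ∃ j < L, c (j + 1) < c j := by
  by_contra! H
  have hz : ∀ i ≤ L, c (L - i) = 0 := fun i => by
    induction i with
    | zero => exact fun _ => h.eq_zero L le_rfl
    | succ i ih =>
      intro hi
      have h1 := H (L - (i + 1)) (by omega)
      rw [show L - (i + 1) + 1 = L - i by omega, ih (by omega)] at h1
      omega
  have h0 : ∑ j ∈ Finset.range L, c j = 0 := Finset.sum_eq_zero fun j hj => by
    have hj := Finset.mem_range.1 hj
    have := hz (L - j) (by omega)
    rwa [Nat.sub_sub_self hj.le] at this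
  have := h.sum_eq
  omega

theorem IsShape.exists_flagPoly_eq (h : IsShape L n c) :
    ∃ T : ℤ[X], flagPoly L n c = (1 - X) ^ n * T ∧ 0 < T.eval 1 := by
  induction n generalizing c with
  | zero => exact ⟨1, by simp [flagPoly], by simp⟩
  | succ n ih =>
    have hT : ∀ j, ∃ T : ℤ[X], j < L → c (j + 1) < c j →
        flagPoly L n (c - Pi.single j 1) = (1 - X) ^ n * T ∧ 0 < T.eval 1 := fun j => by
      by_cases hj : j < L ∧ c (j + 1) < c j
      · obtain ⟨b, hb, rfl⟩ := h.exists_eq_add_single hj.1 hj.2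
        obtain ⟨T, hT⟩ := ih hb
        exact ⟨T, fun _ _ => by simpa using hT⟩
      · exact ⟨0, fun h1 h2 => (hj ⟨h1, h2⟩).elim⟩
    choose T hT using hT
    refine ⟨∑ j ∈ Finset.range L with c (j + 1) < c j,
      X ^ c (j + 1) * (∑ i ∈ Finset.range (c j - c (j + 1)), X ^ i) * T j, ?_, ?_⟩
    · rw [flagPoly_succ_eq_sum_corners h, Finset.mul_sum]
      refine Finset.sum_congr rfl fun j hj => ?_
      rw [Finset.mem_filter, Finset.mem_range] at hj
      have hpow : (X : ℤ[X]) ^ c j = X ^ c (j + 1) * X ^ (c j - c (j + 1)) := by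
        rw [← pow_add, Nat.add_sub_cancel' hj.2.le]
      rw [(hT j hj.1 hj.2).1, hpow]
      linear_combination (-X ^ c (j + 1) * (1 - X) ^ n * T j) *
        mul_neg_geom_sum (X : ℤ[X]) (c j - c (j + 1))
    · rw [eval_finsetSum]
      refine Finset.sum_pos (fun j hj => ?_) ?_
      · rw [Finset.mem_filter, Finset.mem_range] at hj
        have h1 := (hT j hj.1 hj.2).2
        simp only [eval_mul, eval_pow, eval_X, one_pow, one_mul, eval_finsetSum,
          Finset.sum_const, Finset.card_range, nsmul_eq_mul, mul_one]
        exact mul_pos (by exact_mod_cast Nat.sub_pos_of_lt hj.2) h1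
      · obtain ⟨j, hj, hc⟩ := h.exists_corner
        exact ⟨j, Finset.mem_filter.2 ⟨Finset.mem_range.2 hj, hc⟩⟩

theorem IsShape.flagPoly_eq_qPoch (h : IsShape L n c) (h1 : c 1 = 0) :
    flagPoly L n c = qPoch (c 0) := by
  induction n generalizing c with
  | zero =>
    have h0 : c 0 = 0 := by
      rcases Nat.eq_zero_or_pos L with hL | hL
      · exact h.eq_zero 0 hL.le
      · exact Finset.sum_eq_zero_iff.1 h.sum_eq 0 (Finset.mem_range.2 hL)
    simp [flagPoly, qPoch, h0]
  | succ n ih =>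
    have hj0 : ∀ j, c (j + 1) < c j → j = 0 := fun j hj => by
      by_contra hne
      have := h.antitone (Nat.one_le_iff_ne_zero.2 hne)
      omega
    obtain ⟨j, hj, hc⟩ := h.exists_corner
    obtain rfl := hj0 j hc
    have hf : {j ∈ Finset.range L | c (j + 1) < c j} = {0} := by
      ext i
      simp only [Finset.mem_filter, Finset.mem_range, Finset.mem_singleton]
      exact ⟨fun hi => hj0 i hi.2, fun hi => hi ▸ ⟨hj, hc⟩⟩
    rw [flagPoly_succ_eq_sum_corners h, hf, Finset.sum_singleton]
    obtain ⟨b, hb, rfl⟩ := h.exists_eq_add_single hj hc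
    have hb1 : b 1 = 0 := by simpa using h1
    rw [add_tsub_cancel_right, ih hb hb1]
    simp [hb1, qPoch_succ, mul_comm]

theorem X_pow_dvd_qPoch_succ_sub (k : ℕ) : X ^ (k + 1) ∣ qPoch (k + 1) - qPoch k :=
  ⟨-qPoch k, by rw [qPoch_succ]; ring⟩

theorem IsShape.X_pow_dvd_flagPoly_sub (h : IsShape L n c) :
    X ^ (c 0 - c 1 + 1) ∣ flagPoly L n c - qPoch (c 0 - c 1) := by
  induction n generalizing c with
  | zero =>
    have h1 : c 1 = 0 := by
      rcases lt_or_ge 1 L with hL | hL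
      · exact Finset.sum_eq_zero_iff.1 h.sum_eq 1 (Finset.mem_range.2 hL)
      · exact h.eq_zero 1 hL
    simp [h.flagPoly_eq_qPoch h1, h1]
  | succ n ih =>
    rcases Nat.eq_zero_or_pos (c 1) with h1 | h1
    · simp [h.flagPoly_eq_qPoch h1, h1]
    have htele : ∑ j ∈ Finset.range L, ((X : ℤ[X]) ^ c (j + 1) - X ^ c j) = 1 - X ^ c 0 := by
      rw [Finset.sum_range_sub fun j => (X : ℤ[X]) ^ c j, h.eq_zero L le_rfl, pow_zero]
    have hsplit : flagPoly L (n + 1) c - qPoch (c 0 - c 1) =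
        ∑ j ∈ Finset.range L, (X ^ c (j + 1) - X ^ c j) *
          (flagPoly L n (c - Pi.single j 1) - qPoch (c 0 - c 1))
        - X ^ c 0 * qPoch (c 0 - c 1) := by
      simp only [mul_sub, Finset.sum_sub_distrib, ← Finset.sum_mul, flagPoly]
      rw [← Finset.sum_sub_distrib, htele]
      ring
    have h10 := h.antitone zero_le_one
    rw [hsplit]
    refine dvd_sub (Finset.dvd_sum fun j hj => ?_)
      (Dvd.dvd.mul_right (pow_dvd_pow _ (by omega)) _)
    by_cases hc : c (j + 1) < c j
    · obtain ⟨b, hb, rfl⟩ := h.exists_eq_add_single (Finset.mem_range.1 hj) hc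
      have hb10 := hb.antitone zero_le_one
      rw [add_tsub_cancel_right]
      have hdvd := ih hb
      rcases j with _ | _ | j
      · simp only [Pi.add_apply, Pi.single_eq_same, ne_eq, one_ne_zero, not_false_eq_true,
          Pi.single_eq_of_ne, add_zero, zero_add] at h1 ⊢
        rw [show b 0 + 1 - b 1 = b 0 - b 1 + 1 by omega, pow_succ']
        refine mul_dvd_mul (dvd_sub (dvd_pow_self _ h1.ne') (dvd_pow_self _ (by omega))) ?_
        rw [← sub_sub_sub_cancel_right _ _ (qPoch (b 0 - b 1))]
        exact dvd_sub hdvd (X_pow_dvd_qPoch_succ_sub _)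
      · have h0' : (b + Pi.single (0 + 1) 1 : ℕ → ℕ) 0 = b 0 := by simp
        have h1' : (b + Pi.single (0 + 1) 1 : ℕ → ℕ) 1 = b 1 + 1 := by simp
        rw [h0', h1'] at h10 ⊢
        refine Dvd.dvd.mul_left ?_ _
        rw [show b 0 - b 1 = b 0 - (b 1 + 1) + 1 by omega] at hdvd
        rw [← sub_add_sub_cancel _ (qPoch (b 0 - (b 1 + 1) + 1))]
        exact dvd_add ((pow_dvd_pow _ (by omega)).trans hdvd) (X_pow_dvd_qPoch_succ_sub _)
      · simp only [Pi.add_apply]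
        rw [Pi.single_eq_of_ne (by omega), Pi.single_eq_of_ne (by omega)]
        exact Dvd.dvd.mul_left hdvd _
    · rw [le_antisymm (not_lt.1 hc) (h.antitone (Nat.le_succ j)), sub_self, zero_mul]
      exact dvd_zero _

end Recursion

section Count

variable {L n : ℕ} {b c : ℕ → ℕ}

/-- The exponent of `q` by which the number of matrices of column shape `c` falls short of a
multiple of `q ^ n.choose 2`. -/
def defect (L : ℕ) (c : ℕ → ℕ) : ℕ :=
  (c 0).choose 2 + ∑ i ∈ Finset.range L, c i * c (i + 1)

/-- The product of the polynomials `qPoch m` over the multiplicities `m` of the parts of the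
partition with column lengths `c`. -/
noncomputable def multPoch (L : ℕ) (c : ℕ → ℕ) : ℤ[X] :=
  ∏ i ∈ Finset.range L, qPoch (c i - c (i + 1))

theorem defect_add_single_zero (hL : 0 < L) :
    defect L (b + Pi.single 0 1) = defect L b + b 0 + b 1 := by
  have h : ∀ i ∈ Finset.range L,
      (b + Pi.single 0 1 : ℕ → ℕ) i * (b + Pi.single 0 1 : ℕ → ℕ) (i + 1) =
      b i * b (i + 1) + if i = 0 then b 1 else 0 := fun i _ => by
    cases i <;> simp [add_mul]
  rw [defect, Finset.sum_congr rfl h, Finset.sum_add_distrib, Finset.sum_ite_eq',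
    if_pos (Finset.mem_range.2 hL), defect, Pi.add_apply, Pi.single_eq_same,
    Nat.choose_succ_succ' (b 0) 1, Nat.choose_one_right]
  ring

theorem defect_add_single_succ {j : ℕ} (hj : j + 1 < L) :
    defect L (b + Pi.single (j + 1) 1) = defect L b + b j + b (j + 2) := by
  have h : ∀ i ∈ Finset.range L,
      (b + Pi.single (j + 1) 1 : ℕ → ℕ) i * (b + Pi.single (j + 1) 1 : ℕ → ℕ) (i + 1) =
      b i * b (i + 1) + ((if i = j then b j else 0) + if i = j + 1 then b (j + 2) else 0) :=
    fun i _ => by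
      simp only [Pi.add_apply, Pi.single_apply, add_left_inj]
      split_ifs <;> subst_vars <;> first | omega | ring_nf
  rw [defect, Finset.sum_congr rfl h, Finset.sum_add_distrib, Finset.sum_add_distrib,
    Finset.sum_ite_eq', Finset.sum_ite_eq', if_pos (Finset.mem_range.2 (by omega)),
    if_pos (Finset.mem_range.2 hj), defect, Pi.add_apply, Pi.single_eq_of_ne (by omega)]
  ring_nf

theorem multPoch_add_single_zero (hL : 0 < L) (hb : Antitone b) :
    multPoch L (b + Pi.single 0 1) = multPoch L b * (1 - X ^ (b 0 - b 1 + 1)) := by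
  have h : ∀ i ∈ Finset.range L,
      qPoch ((b + Pi.single 0 1 : ℕ → ℕ) i - (b + Pi.single 0 1 : ℕ → ℕ) (i + 1)) =
      qPoch (b i - b (i + 1)) * if i = 0 then 1 - X ^ (b 0 - b 1 + 1) else 1 := fun i _ => by
    have := hb (Nat.le_succ i)
    cases i with
    | zero => simp [← qPoch_succ, Nat.sub_add_comm this]
    | succ i => simp
  rw [multPoch, Finset.prod_congr rfl h, Finset.prod_mul_distrib, Finset.prod_ite_eq',
    if_pos (Finset.mem_range.2 hL), multPoch]

theorem multPoch_add_single_succ {j : ℕ} (hj : j + 1 < L) (hb : Antitone b)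
    (hlt : b (j + 1) < b j) :
    multPoch L (b + Pi.single (j + 1) 1) * (1 - X ^ (b j - b (j + 1))) =
      multPoch L b * (1 - X ^ (b (j + 1) - b (j + 2) + 1)) := by
  have h : ∀ i ∈ Finset.range L,
      qPoch ((b + Pi.single (j + 1) 1 : ℕ → ℕ) i - (b + Pi.single (j + 1) 1 : ℕ → ℕ) (i + 1)) *
        (if i = j then 1 - X ^ (b j - b (j + 1)) else 1) =
      qPoch (b i - b (i + 1)) *
        if i = j + 1 then 1 - X ^ (b (j + 1) - b (j + 2) + 1) else 1 := fun i _ => by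
    have := hb (Nat.le_succ i)
    by_cases h1 : i = j
    · subst h1
      obtain ⟨a, ha⟩ := Nat.exists_eq_add_of_lt hlt
      simp only [Pi.add_apply, Pi.single_eq_same, if_true]
      rw [Pi.single_eq_of_ne (by omega), if_neg (by omega),
        show b i + 0 - (b (i + 1) + 1) = a by omega,
        show b i - b (i + 1) = a + 1 by omega, qPoch_succ, mul_one]
    · by_cases h2 : i = j + 1
      · subst h2
        simp [← qPoch_succ, Nat.sub_add_comm this]
      · simp [h1, h2]
  have hp := Finset.prod_congr rfl h
  rwa [Finset.prod_mul_distrib, Finset.prod_mul_distrib, Finset.prod_ite_eq',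
    Finset.prod_ite_eq', if_pos (Finset.mem_range.2 (by omega)),
    if_pos (Finset.mem_range.2 hj)] at hp

theorem columnCount_eq_zero {F : Type} [Field F] (hc : ¬Antitone c) :
    columnCount F n c = 0 := by
  rw [columnCount, Nat.card_eq_zero]
  exact Or.inl ⟨fun A => hc A.2.2.antitone⟩

theorem columnCount_zero {F : Type} [Field F] (hc : c = 0) : columnCount F 0 c = 1 := by
  subst hc
  rw [columnCount, Nat.card_eq_one_iff_unique]
  refine ⟨inferInstance, ⟨0, fun i => i.elim0, fun k => ?_⟩⟩
  have h : ∀ A : Matrix (Fin 0) (Fin 0) F, A.rank = 0 := fun A => by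
    simpa using A.rank_le_width
  simp [h]

theorem IsShape.eq_zero_of_size_zero (h : IsShape L 0 c) : c = 0 := by
  funext j
  rcases lt_or_ge j L with hj | hj
  · exact Finset.sum_eq_zero_iff.1 h.sum_eq j (Finset.mem_range.2 hj)
  · exact h.eq_zero j hj

/-- The contribution of a corner to the recursion for the number of matrices. -/
theorem boxWeight_mul_eq {q : ℤ} {j : ℕ} {N V : ℤ} (hj : j < L) (hb : IsShape L n b)
    (hc : IsShape L (n + 1) (b + Pi.single j 1))
    (ih : (-1) ^ (n + b 0) * N * q ^ defect L b * (multPoch L b).eval q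
      = q ^ n.choose 2 * V) :
    (-1) ^ (n + 1 + (b + Pi.single j 1 : ℕ → ℕ) 0) * (boxWeight q n b j * N)
        * q ^ defect L (b + Pi.single j 1) * (multPoch L (b + Pi.single j 1)).eval q
      = q ^ (n + 1).choose 2 * ((q ^ (b + Pi.single j 1 : ℕ → ℕ) (j + 1)
        - q ^ (b + Pi.single j 1 : ℕ → ℕ) j) * V) := by
  have hle : ∀ i < L, b i ≤ n := fun i hi =>
    hb.sum_eq ▸ Finset.single_le_sum (fun _ _ => Nat.zero_le _) (Finset.mem_range.2 hi)
  rw [Nat.choose_succ_succ' n 1, Nat.choose_one_right]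
  cases j with
  | zero =>
    obtain ⟨m, hm⟩ := Nat.exists_eq_add_of_le (hle 0 hj)
    obtain ⟨a, ha⟩ := Nat.exists_eq_add_of_le (hb.antitone zero_le_one)
    rw [defect_add_single_zero hj, multPoch_add_single_zero hj hb.antitone, boxWeight]
    simp only [Pi.add_apply, Pi.single_eq_same, eval_mul, eval_sub, eval_one, eval_pow, eval_X]
    rw [Pi.single_eq_of_ne (by omega), Nat.sub_eq_of_eq_add' hm,
      Nat.sub_eq_of_eq_add' ha]
    have hn : q ^ n = q ^ b 1 * q ^ a * q ^ m := by rw [hm, ha]; ring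
    have h0 : q ^ b 0 = q ^ b 1 * q ^ a := by rw [ha]; ring
    simp only [pow_add, hn, h0, pow_one, add_zero, zero_add] at ih ⊢
    linear_combination (q ^ b 1 * q ^ a * q ^ m * q ^ b 1 * (1 - q ^ a * q)) * ih
  | succ j =>
    have hlt : b (j + 1) < b j := by
      have := hc.antitone (Nat.le_succ j)
      simp at this
      omega
    obtain ⟨m, hm⟩ := Nat.exists_eq_add_of_le (hle j (by omega))
    obtain ⟨a, ha⟩ := Nat.exists_eq_add_of_le hlt.le
    obtain ⟨a', ha'⟩ := Nat.exists_eq_add_of_le (hb.antitone (Nat.le_succ (j + 1)))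
    have hmul := congrArg (eval q) (multPoch_add_single_succ hj hb.antitone hlt)
    rw [defect_add_single_succ hj, boxWeight]
    simp only [Pi.add_apply, Pi.single_eq_same, eval_mul, eval_sub, eval_one, eval_pow, eval_X]
      at hmul ⊢
    rw [Nat.sub_eq_of_eq_add' ha, Nat.sub_eq_of_eq_add' ha'] at hmul
    rw [Pi.single_eq_of_ne (by omega), Pi.single_eq_of_ne (by omega), Nat.sub_eq_of_eq_add' hm,
      show n - b (j + 1) = a + m by omega]
    have hn : q ^ n = q ^ b j * q ^ m := by rw [hm]; ring
    have h1 : q ^ b (j + 1) = q ^ b (j + 2) * q ^ a' := by rw [ha']; ring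
    simp only [pow_add, hn, h1, pow_one, add_zero] at ih hmul ⊢
    linear_combination (q ^ b j * q ^ m * q ^ b (j + 2) * (1 - q ^ a' * q)) * ih
      + (-1) ^ n * (-1) ^ b 0 * N * q ^ defect L b * q ^ b j * q ^ m * q ^ b (j + 2) * hmul

theorem IsShape.columnCount_mul_eq {F : Type} [Field F] [Fintype F] (h : IsShape L n c) :
    (-1) ^ (n + c 0) * (columnCount F n c : ℤ) * (Fintype.card F : ℤ) ^ defect L c
        * (multPoch L c).eval (Fintype.card F : ℤ)
      = (Fintype.card F : ℤ) ^ n.choose 2 * (flagPoly L n c).eval (Fintype.card F : ℤ) := by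
  induction n generalizing c with
  | zero =>
    obtain rfl := h.eq_zero_of_size_zero
    simp [columnCount_zero, defect, multPoch, flagPoly, qPoch]
  | succ n ih =>
    rw [flagPoly_succ_eq_sum_corners h, columnCount_succ h.sum_eq, eval_finsetSum,
      Finset.sum_filter, Finset.mul_sum, Finset.sum_mul, Finset.sum_mul, Finset.mul_sum]
    refine Finset.sum_congr rfl fun j hj => ?_
    have hj := Finset.mem_range.1 hj
    split_ifs with h1 h2 h2
    · obtain ⟨b, hb, rfl⟩ := h.exists_eq_add_single hj h2
      have key := boxWeight_mul_eq hj hb h (ih hb)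
      rw [add_tsub_cancel_right]
      simpa using key
    · rw [columnCount_eq_zero]
      · simp
      · intro hanti
        have := hanti (Nat.le_succ j)
        simp at this
        omega
    · omega
    · simp

end Count

section Partitions

theorem card_filter_le_eq_add {s : Finset ℕ} (f : ℕ → ℕ) (k : ℕ) :
    (s.filter fun i => k ≤ f i).card
      = (s.filter fun i => k + 1 ≤ f i).card + (s.filter fun i => f i = k).card := by
  rw [← Finset.card_union_of_disjoint, ← Finset.filter_or]
  · congr 1
    exact Finset.filter_congr fun i _ => by omega
  · exact Finset.disjoint_filter.2 fun i _ h => by omega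

theorem sum_tsub_add_sum_dualPart (f : ℕ → ℕ) (N k : ℕ) :
    ∑ i ∈ Finset.Icc 1 N, (f i - k) + ∑ j ∈ Finset.range k, dualPart f N (j + 1)
      = ∑ i ∈ Finset.Icc 1 N, f i := by
  induction k with
  | zero => simp
  | succ k ih =>
    have h : ∑ i ∈ Finset.Icc 1 N, (f i - k)
        = ∑ i ∈ Finset.Icc 1 N, (f i - (k + 1)) + dualPart f N (k + 1) := by
      rw [dualPart, Finset.card_filter, ← Finset.sum_add_distrib]
      refine Finset.sum_congr rfl fun i _ => ?_
      split_ifs <;> omega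
    rw [Finset.sum_range_succ]
    omega

theorem hasColumns_dualPart_iff {F : Type} [Field F] {n : ℕ} {f : ℕ → ℕ} {N : ℕ}
    (hsum : ∑ i ∈ Finset.Icc 1 N, f i = n) (A : Matrix (Fin n) (Fin n) F) :
    HasColumns A (fun j => dualPart f N (j + 1)) ↔ HasJordanType A f N := by
  constructor
  · intro h k
    have h1 := h.rank_pow_add_sum k
    have h2 := sum_tsub_add_sum_dualPart f N k
    omega
  · intro h k
    have h1 := sum_tsub_add_sum_dualPart f N k
    have h2 := sum_tsub_add_sum_dualPart f N (k + 1)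
    rw [Finset.sum_range_succ] at h2
    change (A ^ k).rank = (A ^ (k + 1)).rank + dualPart f N (k + 1)
    rw [h k, h (k + 1)]
    omega

theorem jordanCount_eq_columnCount {F : Type} [Field F] [Fintype F] {n : ℕ} {f : ℕ → ℕ} {N : ℕ}
    (hsum : ∑ i ∈ Finset.Icc 1 N, f i = n) :
    jordanCount n f N F = columnCount F n fun j => dualPart f N (j + 1) := by
  unfold jordanCount columnCount
  simp only [hasColumns_dualPart_iff hsum]

theorem isShape_dualPart {n L : ℕ} {f : ℕ → ℕ} {N : ℕ}
    (hsum : ∑ i ∈ Finset.Icc 1 N, f i = n) (hL : ∀ i, f i ≤ L) :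
    IsShape L n fun j => dualPart f N (j + 1) where
  antitone j j' hj := Finset.card_le_card
    (Finset.monotone_filter_right _ fun i _ (h : j' + 1 ≤ f i) => (by omega : j + 1 ≤ f i))
  eq_zero j hj := by
    rw [dualPart, Finset.card_eq_zero, Finset.filter_eq_empty_iff]
    intro i _ h
    have := hL i
    omega
  sum_eq := by
    have h := sum_tsub_add_sum_dualPart f N L
    have h0 : ∑ i ∈ Finset.Icc 1 N, (f i - L) = 0 :=
      Finset.sum_eq_zero fun i _ => Nat.sub_eq_zero_of_le (hL i)
    omega

variable {f : ℕ → ℕ} {r : ℕ}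

theorem dualPart_extendOnes_one (h1 : ∀ i, 1 ≤ i → i ≤ r → 1 ≤ f i) (k : ℕ) :
    dualPart (extendOnes f r k) (r + k) 1 = r + k := by
  rw [dualPart, Finset.filter_true_of_mem, Nat.card_Icc, Nat.add_sub_cancel]
  intro i hi
  rw [Finset.mem_Icc] at hi
  unfold extendOnes
  split_ifs with hr
  · exact h1 i hi.1 hr
  · exact le_rfl
  · omega

theorem dualPart_extendOnes {j : ℕ} (hj : 2 ≤ j) (k : ℕ) :
    dualPart (extendOnes f r k) (r + k) j = dualPart f r j := by
  unfold dualPart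
  congr 1
  ext i
  rw [Finset.mem_filter, Finset.mem_filter, Finset.mem_Icc, Finset.mem_Icc, extendOnes]
  split_ifs <;> constructor <;> intro h <;> omega

theorem sum_extendOnes (k : ℕ) :
    ∑ i ∈ Finset.Icc 1 (r + k), extendOnes f r k i = ∑ i ∈ Finset.Icc 1 r, f i + k := by
  have h : ∀ m ≤ k, ∑ i ∈ Finset.Icc 1 (r + m), extendOnes f r k i
      = ∑ i ∈ Finset.Icc 1 r, f i + m := fun m => by
    induction m with
    | zero =>
      intro _
      refine Finset.sum_congr rfl fun i hi => if_pos (Finset.mem_Icc.1 hi).2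
    | succ m ih =>
      intro hm
      rw [← add_assoc, Finset.sum_Icc_succ_top (by omega), ih (by omega), extendOnes,
        if_neg (by omega), if_pos (by omega), add_assoc]
  exact h k le_rfl

theorem multPoch_succ_eq {L : ℕ} {c : ℕ → ℕ} (hc : Antitone c)
    (h : ∀ j, c (j + 1) ≤ c (j + 2) + 1) (hL : c (L + 1) = 0) :
    multPoch (L + 1) c = qPoch (c 0 - c 1) * (1 - X) ^ c 1 := by
  have hq : ∀ j, qPoch (c (j + 1) - c (j + 2)) = (1 - X) ^ (c (j + 1) - c (j + 2)) := fun j => by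
    have := h j
    obtain h0 | h0 : c (j + 1) - c (j + 2) = 0 ∨ c (j + 1) - c (j + 2) = 1 := by omega
    · simp [h0, qPoch]
    · simp [h0, qPoch]
  have hs : ∀ m, ∑ j ∈ Finset.range m, (c (j + 1) - c (j + 2)) + c (m + 1) = c 1 := fun m => by
    induction m with
    | zero => simp
    | succ m ih =>
      have : c (m + 2) ≤ c (m + 1) := hc (Nat.le_succ (m + 1))
      rw [Finset.sum_range_succ]
      change _ + c (m + 2) = c 1
      omega
  have hs' := hs L
  rw [hL, add_zero] at hs'
  rw [multPoch, Finset.prod_range_succ', mul_comm, Finset.prod_congr rfl fun j _ => hq j,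
    Finset.prod_pow_eq_pow_sum, hs']

end Partitions

section Polynomials

theorem qPoch_coeff_zero (k : ℕ) : (qPoch k).coeff 0 = 1 := by
  rw [coeff_zero_eq_eval_zero, qPoch, eval_prod]
  simp

theorem exists_qPoch_eq (k : ℕ) : ∃ Q : ℤ[X], qPoch k = (1 - X) ^ k * Q ∧ 0 < Q.eval 1 := by
  induction k with
  | zero => exact ⟨1, by simp [qPoch], by simp⟩
  | succ k ih =>
    obtain ⟨Q, hQ, hpos⟩ := ih
    refine ⟨Q * ∑ i ∈ Finset.range (k + 1), X ^ i, ?_, ?_⟩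
    · rw [qPoch_succ, hQ, ← mul_neg_geom_sum]
      ring
    · simp only [eval_mul, eval_finsetSum, eval_pow, eval_X, one_pow, Finset.sum_const,
        Finset.card_range, nsmul_eq_mul, mul_one]
      exact mul_pos hpos (by exact_mod_cast Nat.succ_pos k)

theorem eq_of_pow_mul_eq_pow_mul {p U V : ℤ[X]} {t : ℤ} {a b : ℕ} (hp : p ≠ 0)
    (ht : p.eval t = 0) (hU : U.eval t ≠ 0) (hV : V.eval t ≠ 0) (h : p ^ a * U = p ^ b * V) :
    U = V := by
  wlog hab : a ≤ b generalizing a b U V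
  · exact (this hV hU h.symm (by omega)).symm
  obtain ⟨m, rfl⟩ := Nat.exists_eq_add_of_le hab
  rw [pow_add, mul_assoc] at h
  have h' := mul_left_cancel₀ (pow_ne_zero a hp) h
  cases m with
  | zero => simpa using h'
  | succ m => exact (hU (by rw [h']; simp [ht])).elim

theorem eq_of_eval_prime_eq {p q : ℤ[X]}
    (h : ∀ ℓ : ℕ, ℓ.Prime → p.eval (ℓ : ℤ) = q.eval (ℓ : ℤ)) : p = q := by
  refine eq_of_infinite_eval_eq p q ?_
  refine (Nat.infinite_setOfPred_prime.image (Nat.cast_injective (R := ℤ)).injOn).mono ?_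
  rintro _ ⟨ℓ, hℓ, rfl⟩
  exact h ℓ hℓ

theorem coeff_mul_one_sub_pow_of_dvd {k M : ℕ} {R : ℤ[X]}
    (h : X ^ (k + 1) ∣ qPoch k * (R * (1 - X) ^ M) - qPoch k) {m : ℕ} (hm : m ≤ k) :
    (R * (1 - X) ^ M).coeff m = if m = 0 then 1 else 0 := by
  have hX : ¬(X : ℤ[X]) ∣ qPoch k := by simp [X_dvd_iff, qPoch_coeff_zero]
  have hdvd : X ^ (k + 1) ∣ R * (1 - X) ^ M - 1 :=
    prime_X.pow_dvd_of_dvd_mul_left _ hX (by rwa [mul_sub, mul_one])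
  have hcoeff := X_pow_dvd_iff.1 hdvd m (by omega)
  rw [coeff_sub, sub_eq_zero, coeff_one] at hcoeff
  exact hcoeff

/-- Comparing the multiplicities of the roots `0` and `1` in the counting formula. -/
theorem qPoch_mul_eq_flagPoly {M k r d e D C : ℕ} {R V T : ℤ[X]}
    (hV : V = (1 - X) ^ (M + k) * T) (hT1 : T.eval 1 ≠ 0) (hV0 : V.eval 0 ≠ 0)
    (hR0 : R.eval 0 ≠ 0) (hR1 : R.eval 1 ≠ 0)
    (h : (-1) ^ (M + k + (r + k)) * (X ^ d * (X - 1) ^ e * R) * X ^ D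
      * (qPoch k * (1 - X) ^ r) = X ^ C * V) :
    qPoch k * (R * (1 - X) ^ M) = V := by
  obtain ⟨Q, hQ, hQ1⟩ := exists_qPoch_eq k
  have hT0 : T.eval 0 ≠ 0 := by simpa [hV] using hV0
  have hQ0 : Q.eval 0 ≠ 0 := by
    have := qPoch_coeff_zero k
    rw [coeff_zero_eq_eval_zero, hQ] at this
    intro h0
    simp [h0] at this
  have hneg : ∀ a : ℕ, (1 - X : ℤ[X]) ^ a = (-1) ^ a * (X - 1) ^ a := fun a => by
    rw [← mul_pow]
    ring
  have hsq : ∀ a : ℕ, ((-1 : ℤ[X]) ^ a) * (-1) ^ a = 1 := fun a => by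
    rw [← mul_pow]
    simp
  have hkey : X ^ (d + D) * ((X - 1) ^ (e + k + r) * (R * Q))
      = X ^ C * ((X - 1) ^ (M + k) * T) := by
    rw [hQ, hV, hneg k, hneg r, hneg (M + k)] at h
    simp only [pow_add] at h ⊢
    have hM := hsq M
    have hk := hsq k
    have hr := hsq r
    generalize (-1 : ℤ[X]) ^ M = x at *
    generalize (-1 : ℤ[X]) ^ k = y at *
    generalize (-1 : ℤ[X]) ^ r = z at *
    have hxy : x * x * (y * y) = 1 := by rw [hM, hk, mul_one]
    have hxyz : x * x * (y * y) * (y * y) * (z * z) = 1 := by rw [hxy, hk, hr, mul_one, mul_one]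
    linear_combination (x * y) * h
      - (X ^ d * X ^ D * (R * Q) * ((X - 1) ^ e * (X - 1) ^ k * (X - 1) ^ r)) * hxyz
      + (X ^ C * T * ((X - 1) ^ M * (X - 1) ^ k)) * hxy
  have h1 := eq_of_pow_mul_eq_pow_mul X_ne_zero (t := 0) (by simp) (by simp [hR0, hQ0])
    (by simp [hT0]) hkey
  have h2 := eq_of_pow_mul_eq_pow_mul (p := X - 1) (t := 1) (X_sub_C_ne_zero 1) (by simp)
    (by simp [hR1, hQ1.ne']) hT1 h1
  rw [hV, hQ, ← h2, pow_add]
  ring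

end Polynomials

end JordanCount

theorem R_limit_distinct_parts (M r : ℕ) (f : ℕ → ℕ) (hf : IsPartitionFun f M r)
    (hdist : ∀ i, 1 ≤ i → i < r → f (i + 1) < f i)
    (h2 : ∀ i, 1 ≤ i → i ≤ r → 2 ≤ f i)
    (P R : ℕ → Polynomial ℤ) (d e : ℕ → ℕ)
    (hP : ∀ k : ℕ, ∀ (F : Type) [Field F] [Fintype F],
      (jordanCount (M + k) (extendOnes f r k) (r + k) F : ℤ) =
        (P k).eval (Fintype.card F : ℤ))
    (hfac : ∀ k : ℕ, P k = X ^ (d k) * (X - 1) ^ (e k) * R k)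
    (hR0 : ∀ k : ℕ, (R k).eval 0 ≠ 0) (hR1 : ∀ k : ℕ, (R k).eval 1 ≠ 0) :
    ∀ m : ℕ, ∃ K : ℕ, ∀ k : ℕ, K ≤ k →
      (R k * (1 - X : Polynomial ℤ) ^ M).coeff m = if m = 0 then 1 else 0 := by
  intro m
  refine ⟨m, fun k hk => ?_⟩
  obtain ⟨hanti, -, hsum⟩ := hf
  have hsum' : ∑ i ∈ Finset.Icc 1 (r + k), extendOnes f r k i = M + k := by
    rw [JordanCount.sum_extendOnes, hsum]
  have hL : ∀ i, extendOnes f r k i ≤ f 0 + 1 := fun i => by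
    have := hanti 0 i (Nat.zero_le i)
    unfold extendOnes
    split_ifs <;> omega
  have hshape := JordanCount.isShape_dualPart hsum' hL
  set c : ℕ → ℕ := fun j => dualPart (extendOnes f r k) (r + k) (j + 1) with hc
  have hc0 : c 0 = r + k :=
    JordanCount.dualPart_extendOnes_one (fun i h h' => one_le_two.trans (h2 i h h')) k
  have hc1 : c 1 = r := by
    rw [hc]
    change dualPart _ _ 2 = r
    rw [JordanCount.dualPart_extendOnes le_rfl, dualPart, Finset.filter_true_of_mem,
      Nat.card_Icc, Nat.add_sub_cancel]
    intro i hi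
    rw [Finset.mem_Icc] at hi
    exact h2 i hi.1 hi.2
  have hinj : ∀ i i', 1 ≤ i → i < i' → i' ≤ r → f i' < f i := fun i i' h h' h'' =>
    (hanti (i + 1) i' h').trans_lt (hdist i h (by omega))
  have hmult : ∀ j, c (j + 1) ≤ c (j + 2) + 1 := fun j => by
    rw [hc]
    change dualPart _ _ (j + 2) ≤ dualPart _ _ (j + 2 + 1) + 1
    rw [JordanCount.dualPart_extendOnes (by omega), JordanCount.dualPart_extendOnes (by omega),
      dualPart, dualPart, JordanCount.card_filter_le_eq_add]
    refine Nat.add_le_add_left (Finset.card_le_one.2 fun i hi i' hi' => ?_) _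
    simp only [Finset.mem_filter, Finset.mem_Icc] at hi hi'
    by_contra hne
    rcases lt_or_gt_of_ne hne with hlt | hlt
    · have := hinj i i' hi.1.1 hlt hi'.1.2
      omega
    · have := hinj i' i hi'.1.1 hlt hi.1.2
      omega
  have hpoly : (-1) ^ (M + k + (r + k)) * P k * X ^ JordanCount.defect (f 0 + 1) c
      * JordanCount.multPoch (f 0 + 1) c
      = X ^ (M + k).choose 2 * JordanCount.flagPoly (f 0 + 1) (M + k) c := by
    refine JordanCount.eq_of_eval_prime_eq fun ℓ hℓ => ?_
    have := Fact.mk hℓ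
    have h := hshape.columnCount_mul_eq (F := ZMod ℓ)
    rw [← JordanCount.jordanCount_eq_columnCount hsum', hP, ZMod.card, hc0] at h
    simpa using h
  rw [JordanCount.multPoch_succ_eq hshape.antitone hmult (hshape.eq_zero _ le_rfl), hc1, hc0,
    Nat.add_sub_cancel_left, hfac k] at hpoly
  have hdvd := hshape.X_pow_dvd_flagPoly_sub
  rw [hc1, hc0, Nat.add_sub_cancel_left] at hdvd
  obtain ⟨T, hT, hT1⟩ := hshape.exists_flagPoly_eq
  have hV0 : (JordanCount.flagPoly (f 0 + 1) (M + k) c).eval 0 ≠ 0 := by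
    have h := X_pow_dvd_iff.1 hdvd 0 (Nat.succ_pos k)
    rw [coeff_sub, JordanCount.qPoch_coeff_zero, coeff_zero_eq_eval_zero] at h
    omega
  refine JordanCount.coeff_mul_one_sub_pow_of_dvd ?_ hk
  rwa [JordanCount.qPoch_mul_eq_flagPoly hT hT1.ne' hV0 (hR0 k) (hR1 k) hpoly]
end
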